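/- Let (Ω, 𝒜, ℙ) be a probability space and (ℱ_{i,j})_{i,j≥0} a two-parameter filtration satisfying the (F4) condition. Then there is a universal constant C (independent of the probability space, the filtration and f) such that for every f ∈ L¹(ℱ_{∞,∞}), 𝔼[sup_{n,m} |𝔼_{n,m} f|] ≤ C · 𝔼[(Σ_{i,j} |Δ_{i,j} f|²)^{1/2}], i.e. ‖f‖_{H¹_M} ≲ ‖f‖_{H¹_S}. -/

import Mathlib

open MeasureTheory ENNReal

/-- The σ-algebra `ℱ_{i,∞} = ⋁_j ℱ_{i,j}`. -/
def rowSup {Ω : Type*} (𝓕 : ℕ → ℕ → MeasurableSpace Ω) (i : ℕ) : MeasurableSpace Ω :=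
  ⨆ j, 𝓕 i j

/-- The σ-algebra `ℱ_{∞,j} = ⋁_i ℱ_{i,j}`. -/
def colSup {Ω : Type*} (𝓕 : ℕ → ℕ → MeasurableSpace Ω) (j : ℕ) : MeasurableSpace Ω :=
  ⨆ i, 𝓕 i j

/-- A two-parameter filtration satisfying the (F4) condition:
`𝔼_{i,j} 𝔼_{k,l} = 𝔼_{min(i,k),min(j,l)} = 𝔼_{k,l} 𝔼_{i,j}` as operators on `L¹`. -/
structure IsF4Filtration {Ω : Type*} [m0 : MeasurableSpace Ω] (μ : Measure Ω)
    (𝓕 : ℕ → ℕ → MeasurableSpace Ω) : Prop where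
  le : ∀ i j, 𝓕 i j ≤ m0
  mono_left : ∀ i j, 𝓕 i j ≤ 𝓕 (i + 1) j
  mono_right : ∀ i j, 𝓕 i j ≤ 𝓕 i (j + 1)
  f4 : ∀ i j k l : ℕ, ∀ f : Ω → ℝ, Integrable f μ →
    μ[μ[f|𝓕 k l]|𝓕 i j] =ᵐ[μ] μ[f|𝓕 (min i k) (min j l)]

/-- One-parameter martingale difference `Δ^{(1)}_i` with respect to `(ℱ_{i,∞})_i`:
`Δ^{(1)}_0 = 𝔼_{0,∞}` and `Δ^{(1)}_{i+1} = 𝔼_{i+1,∞} - 𝔼_{i,∞}`. -/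
noncomputable def d1 {Ω : Type*} [MeasurableSpace Ω] (μ : Measure Ω)
    (𝓕 : ℕ → ℕ → MeasurableSpace Ω) : ℕ → (Ω → ℝ) → Ω → ℝ
  | 0, f => μ[f|rowSup 𝓕 0]
  | (i + 1), f => μ[f|rowSup 𝓕 (i + 1)] - μ[f|rowSup 𝓕 i]

/-- One-parameter martingale difference `Δ^{(2)}_j` with respect to `(ℱ_{∞,j})_j`. -/
noncomputable def d2 {Ω : Type*} [MeasurableSpace Ω] (μ : Measure Ω)
    (𝓕 : ℕ → ℕ → MeasurableSpace Ω) : ℕ → (Ω → ℝ) → Ω → ℝ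
  | 0, f => μ[f|colSup 𝓕 0]
  | (j + 1), f => μ[f|colSup 𝓕 (j + 1)] - μ[f|colSup 𝓕 j]

/-- The rectangular martingale difference `Δ_{i,j} = Δ^{(1)}_i Δ^{(2)}_j`. -/
noncomputable def dd {Ω : Type*} [MeasurableSpace Ω] (μ : Measure Ω)
    (𝓕 : ℕ → ℕ → MeasurableSpace Ω) (i j : ℕ) (f : Ω → ℝ) : Ω → ℝ :=
  d1 μ 𝓕 i (d2 μ 𝓕 j f)

/-- `f` is a.e. equal to an `m`-measurable function and essentially bounded. -/
def BddMeas {Ω E : Type*} {m0 : MeasurableSpace Ω} [NormedAddCommGroup E] (μ : Measure Ω)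
    (m : MeasurableSpace Ω) (f : Ω → E) : Prop :=
  AEStronglyMeasurable[m] f μ ∧ ∃ K : ℝ, ∀ᵐ ω ∂μ, ‖f ω‖ ≤ K

namespace BddMeas

variable {Ω E F : Type*} {m0 : MeasurableSpace Ω} {μ : Measure Ω} {m m' : MeasurableSpace Ω}
  [NormedAddCommGroup E] [NormedAddCommGroup F]

protected theorem mono {f : Ω → E} (hf : BddMeas μ m f) (h : m ≤ m') : BddMeas μ m' f :=
  ⟨hf.1.mono h, hf.2⟩

protected theorem congr {f g : Ω → E} (hf : BddMeas μ m f) (h : f =ᵐ[μ] g) : BddMeas μ m g := by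
  refine ⟨hf.1.congr h, ?_⟩
  obtain ⟨K, hK⟩ := hf.2
  exact ⟨K, by filter_upwards [hK, h] with ω h1 h2; rwa [← h2]⟩

protected theorem of_le {f : Ω → E} {g : Ω → F} (hg : BddMeas μ m' g)
    (hf : AEStronglyMeasurable[m] f μ) (h : ∀ᵐ ω ∂μ, ‖f ω‖ ≤ ‖g ω‖) : BddMeas μ m f := by
  obtain ⟨K, hK⟩ := hg.2
  exact ⟨hf, K, by filter_upwards [hK, h] with ω h1 h2; exact h2.trans h1⟩

protected theorem const (c : E) : BddMeas μ m (fun _ : Ω => c) :=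
  ⟨aestronglyMeasurable_const, ‖c‖, by simp⟩

protected theorem memLp [IsFiniteMeasure μ] {f : Ω → E} (hf : BddMeas μ m0 f) (p : ℝ≥0∞) :
    MemLp f p μ := by
  obtain ⟨K, hK⟩ := hf.2
  exact MemLp.of_bound hf.1 K hK

protected theorem integrable [IsFiniteMeasure μ] {f : Ω → E} (hf : BddMeas μ m0 f) :
    Integrable f μ :=
  memLp_one_iff_integrable.1 (hf.memLp 1)

protected theorem add {f g : Ω → E} (hf : BddMeas μ m f) (hg : BddMeas μ m g) :
    BddMeas μ m (fun ω => f ω + g ω) := by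
  obtain ⟨K, hK⟩ := hf.2
  obtain ⟨L, hL⟩ := hg.2
  refine ⟨hf.1.add hg.1, K + L, ?_⟩
  filter_upwards [hK, hL] with ω h1 h2
  exact (norm_add_le _ _).trans (by linarith)

protected theorem neg {f : Ω → E} (hf : BddMeas μ m f) : BddMeas μ m (fun ω => -f ω) :=
  hf.of_le hf.1.neg (by simp)

protected theorem sub {f g : Ω → E} (hf : BddMeas μ m f) (hg : BddMeas μ m g) :
    BddMeas μ m (fun ω => f ω - g ω) := by
  simpa [sub_eq_add_neg] using hf.add hg.neg

protected theorem sum {ι : Type*} {f : ι → Ω → E} (s : Finset ι) (hf : ∀ i ∈ s, BddMeas μ m (f i)) :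
    BddMeas μ m (fun ω => ∑ i ∈ s, f i ω) := by
  classical
  induction s using Finset.induction_on with
  | empty => simpa using BddMeas.const (μ := μ) (m := m) (0 : E)
  | insert a s ha ih =>
    simp only [Finset.sum_insert ha]
    exact (hf a (by simp)).add (ih fun i hi => hf i (by simp [hi]))

protected theorem smul [NormedSpace ℝ E] {f : Ω → ℝ} {g : Ω → E} (hf : BddMeas μ m f)
    (hg : BddMeas μ m g) : BddMeas μ m (fun ω => f ω • g ω) := by
  obtain ⟨K, hK⟩ := hf.2
  obtain ⟨L, hL⟩ := hg.2
  refine ⟨hf.1.smul hg.1, K * L, ?_⟩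
  filter_upwards [hK, hL] with ω h1 h2
  rw [norm_smul]
  exact mul_le_mul h1 h2 (norm_nonneg _) ((norm_nonneg _).trans h1)

protected theorem mul {f g : Ω → ℝ} (hf : BddMeas μ m f) (hg : BddMeas μ m g) :
    BddMeas μ m (fun ω => f ω * g ω) := hf.smul hg

protected theorem const_mul {f : Ω → ℝ} (hf : BddMeas μ m f) (c : ℝ) :
    BddMeas μ m (fun ω => c * f ω) := (BddMeas.const c).mul hf

protected theorem sq {f : Ω → ℝ} (hf : BddMeas μ m f) : BddMeas μ m (fun ω => f ω ^ 2) := by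
  simpa [pow_two] using hf.mul hf

protected theorem norm {f : Ω → E} (hf : BddMeas μ m f) : BddMeas μ m (fun ω => ‖f ω‖) :=
  hf.of_le (continuous_norm.comp_aestronglyMeasurable hf.1) (by simp)

protected theorem abs {f : Ω → ℝ} (hf : BddMeas μ m f) : BddMeas μ m (fun ω => |f ω|) := hf.norm

protected theorem normSq {f : Ω → E} (hf : BddMeas μ m f) :
    BddMeas μ m (fun ω => ‖f ω‖ ^ 2) := hf.norm.sq

protected theorem sqrt {f : Ω → ℝ} (hf : BddMeas μ m f) : BddMeas μ m (fun ω => √(f ω)) := by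
  obtain ⟨K, hK⟩ := hf.2
  refine ⟨Real.continuous_sqrt.comp_aestronglyMeasurable hf.1, √K, ?_⟩
  filter_upwards [hK] with ω h
  rw [Real.norm_of_nonneg (Real.sqrt_nonneg _)]
  exact Real.sqrt_le_sqrt ((le_abs_self _).trans h)

protected theorem sup {f g : Ω → ℝ} (hf : BddMeas μ m f) (hg : BddMeas μ m g) :
    BddMeas μ m (fun ω => f ω ⊔ g ω) := by
  refine (hf.norm.add hg.norm).of_le
    (continuous_sup.comp_aestronglyMeasurable (hf.1.prodMk hg.1)) (.of_forall fun ω => ?_)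
  simp only [Real.norm_eq_abs]
  rw [abs_of_nonneg (by positivity : 0 ≤ |f ω| + |g ω|)]
  exact (abs_max_le_max_abs_abs).trans (max_le_add_of_nonneg (abs_nonneg _) (abs_nonneg _))

protected theorem indicator {f : Ω → E} (hf : BddMeas μ m f) {s : Set Ω} (hs : MeasurableSet[m] s) :
    BddMeas μ m (s.indicator f) := by
  refine hf.of_le ⟨s.indicator (hf.1.mk f), hf.1.stronglyMeasurable_mk.indicator hs, ?_⟩
    (.of_forall fun ω => norm_indicator_le_norm_self f ω)
  filter_upwards [hf.1.ae_eq_mk] with ω h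
  by_cases hω : ω ∈ s <;> simp [hω, h]

protected theorem inner [InnerProductSpace ℝ E] {f g : Ω → E} (hf : BddMeas μ m f)
    (hg : BddMeas μ m g) : BddMeas μ m (fun ω => inner ℝ (f ω) (g ω)) := by
  refine (hf.norm.mul hg.norm).of_le
    (continuous_inner.comp_aestronglyMeasurable (hf.1.prodMk hg.1)) (.of_forall fun ω => ?_)
  rw [Real.norm_of_nonneg (r := ‖f ω‖ * ‖g ω‖) (by positivity)]
  exact norm_inner_le_norm _ _

variable [NormedSpace ℝ E] [CompleteSpace E] [IsFiniteMeasure μ]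

protected theorem condExp {f : Ω → E} (hf : BddMeas μ m0 f) : BddMeas μ m (μ[f|m]) := by
  by_cases hm : m ≤ m0
  swap
  · rw [condExp_of_not_le hm]; exact BddMeas.const 0
  obtain ⟨K, hK⟩ := hf.2
  refine ⟨stronglyMeasurable_condExp.aestronglyMeasurable, K, ?_⟩
  have h1 := condExp_mono (m := m) hf.norm.integrable (integrable_const K) hK
  rw [condExp_const hm] at h1
  filter_upwards [h1, norm_condExp_le (m := m) (μ := μ) f] with ω h1 h2
  exact h2.trans h1

protected theorem condExp' {f : Ω → E} (hf : BddMeas μ m0 f) : BddMeas μ m0 (μ[f|m]) := by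
  by_cases hm : m ≤ m0
  · exact (hf.condExp (m := m)).mono hm
  · rw [condExp_of_not_le hm]; exact BddMeas.const 0

protected theorem condExp_eq {f : Ω → E} (hf : BddMeas μ m f) (hm : m ≤ m0) : μ[f|m] =ᵐ[μ] f :=
  condExp_of_aestronglyMeasurable' hm hf.1 (hf.mono hm).integrable

protected theorem condExp_smul_left {f : Ω → ℝ} {g : Ω → E} (hf : BddMeas μ m f)
    (hg : BddMeas μ m0 g) (hm : m ≤ m0) : μ[fun ω => f ω • g ω|m] =ᵐ[μ] fun ω => f ω • (μ[g|m]) ω :=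
  condExp_smul_of_aestronglyMeasurable_left hf.1 ((hf.mono hm).smul hg).integrable hg.integrable

protected theorem condExp_mul_left {f g : Ω → ℝ} (hf : BddMeas μ m f) (hg : BddMeas μ m0 g)
    (hm : m ≤ m0) : μ[fun ω => f ω * g ω|m] =ᵐ[μ] fun ω => f ω * (μ[g|m]) ω :=
  hf.condExp_smul_left hg hm

protected theorem condExp_add {f g : Ω → E} (hf : BddMeas μ m0 f) (hg : BddMeas μ m0 g) :
    μ[fun ω => f ω + g ω|m] =ᵐ[μ] fun ω => (μ[f|m]) ω + (μ[g|m]) ω :=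
  MeasureTheory.condExp_add hf.integrable hg.integrable m

protected theorem condExp_sub {f g : Ω → E} (hf : BddMeas μ m0 f) (hg : BddMeas μ m0 g) :
    μ[fun ω => f ω - g ω|m] =ᵐ[μ] fun ω => (μ[f|m]) ω - (μ[g|m]) ω :=
  MeasureTheory.condExp_sub hf.integrable hg.integrable m

protected theorem condExp_sum {ι : Type*} {f : ι → Ω → E} (s : Finset ι)
    (hf : ∀ i ∈ s, BddMeas μ m0 (f i)) :
    μ[fun ω => ∑ i ∈ s, f i ω|m] =ᵐ[μ] fun ω => ∑ i ∈ s, (μ[f i|m]) ω := by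
  have h := condExp_finsetSum (m := m) (fun i hi => (hf i hi).integrable)
  have e : (∑ i ∈ s, f i) = fun ω => ∑ i ∈ s, f i ω := by ext; simp
  rw [e] at h
  filter_upwards [h] with ω h
  simp [h]

protected theorem integral_mul_condExp {f g : Ω → ℝ} (hf : BddMeas μ m f) (hg : BddMeas μ m0 g)
    (hm : m ≤ m0) : ∫ ω, f ω * (μ[g|m]) ω ∂μ = ∫ ω, f ω * g ω ∂μ := by
  rw [← integral_condExp hm (f := fun ω => f ω * g ω)]
  exact integral_congr_ae (hf.condExp_mul_left hg hm).symm

protected theorem integral_mono {f g : Ω → ℝ} (hf : BddMeas μ m0 f) (hg : BddMeas μ m0 g)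
    (h : ∀ᵐ ω ∂μ, f ω ≤ g ω) : ∫ ω, f ω ∂μ ≤ ∫ ω, g ω ∂μ :=
  integral_mono_ae hf.integrable hg.integrable h

protected theorem integral_add {f g : Ω → ℝ} (hf : BddMeas μ m0 f) (hg : BddMeas μ m0 g) :
    ∫ ω, (f ω + g ω) ∂μ = ∫ ω, f ω ∂μ + ∫ ω, g ω ∂μ :=
  MeasureTheory.integral_add hf.integrable hg.integrable

protected theorem integral_sub {f g : Ω → ℝ} (hf : BddMeas μ m0 f) (hg : BddMeas μ m0 g) :
    ∫ ω, (f ω - g ω) ∂μ = ∫ ω, f ω ∂μ - ∫ ω, g ω ∂μ :=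
  MeasureTheory.integral_sub hf.integrable hg.integrable

protected theorem integral_sum {ι : Type*} {f : ι → Ω → ℝ} (s : Finset ι)
    (hf : ∀ i ∈ s, BddMeas μ m0 (f i)) :
    ∫ ω, ∑ i ∈ s, f i ω ∂μ = ∑ i ∈ s, ∫ ω, f i ω ∂μ :=
  MeasureTheory.integral_finsetSum s fun i hi => (hf i hi).integrable

end BddMeas

theorem BddMeas.integral_inner_condExp {Ω E : Type*} {m m0 : MeasurableSpace Ω} {μ : Measure Ω}
    [IsFiniteMeasure μ] [NormedAddCommGroup E] [InnerProductSpace ℝ E] [CompleteSpace E]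
    {f g : Ω → E} (hf : BddMeas μ m f) (hg : BddMeas μ m0 g) (hm : m ≤ m0) :
    ∫ ω, inner ℝ (f ω) ((μ[g|m]) ω) ∂μ = ∫ ω, inner ℝ (f ω) (g ω) ∂μ := by
  rw [← integral_condExp hm (f := fun ω => inner ℝ (f ω) (g ω))]
  exact integral_congr_ae (condExp_bilin_of_aestronglyMeasurable_left (innerSL ℝ) hf.1
    ((hf.mono hm).inner hg).integrable hg.integrable).symm

/-- The compensated sum `∑_{i<n} (y_i - 𝔼[y_i | 𝒢_i])`. -/
noncomputable def compSum {Ω E : Type*} {m0 : MeasurableSpace Ω} [NormedAddCommGroup E]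
    [NormedSpace ℝ E] (𝒢 : Filtration ℕ m0) (μ : Measure Ω) (y : ℕ → Ω → E) (n : ℕ) (ω : Ω) : E :=
  ∑ i ∈ Finset.range n, (y i ω - (μ[y i|𝒢 i]) ω)

theorem compSum_succ {Ω E : Type*} {m0 : MeasurableSpace Ω} {μ : Measure Ω}
    [NormedAddCommGroup E] [NormedSpace ℝ E] {𝒢 : Filtration ℕ m0} {y : ℕ → Ω → E} (n : ℕ)
    (ω : Ω) :
    compSum 𝒢 μ y (n + 1) ω = compSum 𝒢 μ y n ω + (y n ω - (μ[y n|𝒢 n]) ω) := by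
  rw [compSum, Finset.sum_range_succ, compSum]

section OneParameter

variable {Ω E : Type*} {m0 : MeasurableSpace Ω} {μ : Measure Ω} [IsFiniteMeasure μ]
  [NormedAddCommGroup E] [InnerProductSpace ℝ E] [CompleteSpace E]

theorem integral_inner_sub_condExp {m : MeasurableSpace Ω} (hm : m ≤ m0) {f g : Ω → E}
    (hf : BddMeas μ m f) (hg : BddMeas μ m0 g) :
    ∫ ω, inner ℝ (f ω) (g ω - (μ[g|m]) ω) ∂μ = 0 := by
  simp only [inner_sub_right]
  rw [BddMeas.integral_sub ((hf.mono hm).inner hg) ((hf.mono hm).inner hg.condExp'),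
    hf.integral_inner_condExp hg hm, sub_self]

theorem integral_normSq_sub_condExp {m : MeasurableSpace Ω} (hm : m ≤ m0) {g : Ω → E}
    (hg : BddMeas μ m0 g) :
    ∫ ω, ‖g ω - (μ[g|m]) ω‖ ^ 2 ∂μ + ∫ ω, ‖(μ[g|m]) ω‖ ^ 2 ∂μ = ∫ ω, ‖g ω‖ ^ 2 ∂μ := by
  have hP : BddMeas μ m0 (μ[g|m]) := hg.condExp'
  have hP' : BddMeas μ m (μ[g|m]) := hg.condExp
  have hD := hg.sub hP
  have h0 := integral_inner_sub_condExp hm hP' hg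
  have : ∀ ω, ‖g ω‖ ^ 2 = (‖g ω - (μ[g|m]) ω‖ ^ 2 + ‖(μ[g|m]) ω‖ ^ 2)
      + 2 * inner ℝ ((μ[g|m]) ω) (g ω - (μ[g|m]) ω) := by
    intro ω
    have := norm_add_sq_real ((μ[g|m]) ω) (g ω - (μ[g|m]) ω)
    rw [add_sub_cancel] at this
    linarith
  simp_rw [this]
  rw [BddMeas.integral_add (hD.normSq.add hP.normSq) ((hP.inner hD).const_mul 2),
    BddMeas.integral_add hD.normSq hP.normSq, integral_const_mul, h0]
  ring

theorem integral_normSq_condExp_le {m : MeasurableSpace Ω} (hm : m ≤ m0) {g : Ω → E}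
    (hg : BddMeas μ m0 g) : ∫ ω, ‖(μ[g|m]) ω‖ ^ 2 ∂μ ≤ ∫ ω, ‖g ω‖ ^ 2 ∂μ := by
  have := integral_normSq_sub_condExp hm hg
  have h : 0 ≤ ∫ ω, ‖g ω - (μ[g|m]) ω‖ ^ 2 ∂μ := integral_nonneg fun ω => by positivity
  linarith

theorem integral_normSq_sub_condExp_le {m : MeasurableSpace Ω} (hm : m ≤ m0) {g : Ω → E}
    (hg : BddMeas μ m0 g) : ∫ ω, ‖g ω - (μ[g|m]) ω‖ ^ 2 ∂μ ≤ ∫ ω, ‖g ω‖ ^ 2 ∂μ := by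
  have := integral_normSq_sub_condExp hm hg
  have h : 0 ≤ ∫ ω, ‖(μ[g|m]) ω‖ ^ 2 ∂μ := integral_nonneg fun ω => by positivity
  linarith

variable {𝒢 : Filtration ℕ m0} {y : ℕ → Ω → E}

theorem bddMeas_comp (hy : ∀ i, BddMeas μ (𝒢 (i + 1)) (y i)) (i : ℕ) :
    BddMeas μ (𝒢 (i + 1)) (fun ω => y i ω - (μ[y i|𝒢 i]) ω) :=
  (hy i).sub (BddMeas.mono (((hy i).mono (𝒢.le _)).condExp (m := 𝒢 i)) (𝒢.mono (Nat.le_succ i)))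

theorem bddMeas_compSum (hy : ∀ i, BddMeas μ (𝒢 (i + 1)) (y i)) (n : ℕ) :
    BddMeas μ (𝒢 n) (compSum 𝒢 μ y n) :=
  BddMeas.sum _ fun i hi => (bddMeas_comp hy i).mono (𝒢.mono (by simpa using hi))

theorem integral_normSq_compSum_le (hy : ∀ i, BddMeas μ (𝒢 (i + 1)) (y i)) (n : ℕ) :
    ∫ ω, ‖compSum 𝒢 μ y n ω‖ ^ 2 ∂μ ≤ ∑ i ∈ Finset.range n, ∫ ω, ‖y i ω‖ ^ 2 ∂μ := by
  induction n with
  | zero => simp [compSum]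
  | succ n ih =>
    have hS := bddMeas_compSum hy n
    have hS' := hS.mono (𝒢.le n)
    have hD := (bddMeas_comp hy n).mono (𝒢.le _)
    have h0 := integral_inner_sub_condExp (𝒢.le n) hS ((hy n).mono (𝒢.le _))
    have h1 := integral_normSq_sub_condExp_le (𝒢.le n) ((hy n).mono (𝒢.le _))
    simp_rw [compSum_succ, norm_add_sq_real]
    rw [BddMeas.integral_add (hS'.normSq.add ((hS'.inner hD).const_mul 2)) hD.normSq,
      BddMeas.integral_add hS'.normSq ((hS'.inner hD).const_mul 2), integral_const_mul, h0,
      Finset.sum_range_succ]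
    linarith

theorem condExp_compSum (hy : ∀ i, BddMeas μ (𝒢 (i + 1)) (y i)) {n N : ℕ} (h : n ≤ N) :
    μ[compSum 𝒢 μ y N|𝒢 n] =ᵐ[μ] compSum 𝒢 μ y n := by
  induction N, h using Nat.le_induction with
  | base => exact (bddMeas_compSum hy n).condExp_eq (𝒢.le n)
  | succ N hN ih =>
    have e : compSum 𝒢 μ y (N + 1) = fun ω => compSum 𝒢 μ y N ω + (y N ω - (μ[y N|𝒢 N]) ω) := by
      ext ω; exact compSum_succ N ω
    have hyN := (hy N).mono (𝒢.le _)
    rw [e]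
    filter_upwards [BddMeas.condExp_add (m := 𝒢 n) ((bddMeas_compSum hy N).mono (𝒢.le _))
      ((bddMeas_comp hy N).mono (𝒢.le _)), ih, BddMeas.condExp_sub (m := 𝒢 n) hyN hyN.condExp',
      condExp_condExp_of_le (μ := μ) (f := y N) (𝒢.mono hN) (𝒢.le N)] with ω h1 h2 h3 h4
    rw [h1, h2, h3, h4]
    simp

/-- Doob's `L²` maximal inequality. -/
theorem doob_sq (𝒢 : Filtration ℕ m0) {h : Ω → E} (hh : BddMeas μ m0 h) (N : ℕ) :
    ∃ G : Ω → ℝ, BddMeas μ m0 G ∧ (∀ᵐ ω ∂μ, ∀ n ≤ N, ‖(μ[h|𝒢 n]) ω‖ ≤ G ω) ∧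
      ∫ ω, G ω ^ 2 ∂μ ≤ 4 * ∫ ω, ‖h ω‖ ^ 2 ∂μ := by
  let x : ℕ → Ω → ℝ := fun k => μ[fun ω => ‖h ω‖|𝒢 k]
  let M : ℕ → Ω → ℝ := fun n => partialSups x n
  have hMs : ∀ n, M (n + 1) = fun ω => M n ω ⊔ x (n + 1) ω := by
    intro n; ext ω; simp [M, partialSups_add_one]
  have hx : ∀ n, BddMeas μ (𝒢 n) (x n) := fun n => hh.norm.condExp
  have hM : ∀ n, BddMeas μ (𝒢 n) (M n) := by
    intro n
    induction n with
    | zero => simpa [M] using hx 0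
    | succ n ih => rw [hMs]; exact (ih.mono (𝒢.mono n.le_succ)).sup (hx _)
  have hx' := fun n => (hx n).mono (𝒢.le n)
  have hM' := fun n => (hM n).mono (𝒢.le n)
  have key : ∀ n ω, 2 * ∑ k ∈ Finset.range n, M k ω * (x (k + 1) ω - x k ω) ≤
      2 * (M n ω * x n ω) - M n ω ^ 2 := by
    intro n ω
    induction n with
    | zero => simp [M]; nlinarith [sq_nonneg (x 0 ω)]
    | succ n ih =>
      rw [Finset.sum_range_succ, hMs]
      rcases le_total (M n ω) (x (n + 1) ω) with h | h
      · simp only [sup_of_le_right h]; nlinarith [sq_nonneg (M n ω - x (n + 1) ω)]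
      · simp only [sup_of_le_left h]; nlinarith
  have h0 : ∀ k, ∫ ω, M k ω * (x (k + 1) ω - x k ω) ∂μ = 0 := by
    intro k
    simp only [mul_sub]
    rw [BddMeas.integral_sub ((hM' k).mul (hx' _)) ((hM' k).mul (hx' _)),
      (hM k).integral_mul_condExp hh.norm (𝒢.le k),
      ((hM k).mono (𝒢.mono k.le_succ)).integral_mul_condExp hh.norm (𝒢.le _), sub_self]
  have h1 : ∫ ω, 2 * ∑ k ∈ Finset.range N, M k ω * (x (k + 1) ω - x k ω) ∂μ = 0 := by
    rw [integral_const_mul, BddMeas.integral_sum _ fun k _ => (hM' k).mul ((hx' _).sub (hx' _))]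
    simp [h0]
  have h2 : ∫ ω, M N ω ^ 2 ∂μ ≤ 4 * ∫ ω, x N ω ^ 2 ∂μ := by
    have := BddMeas.integral_mono (μ := μ)
      (f := fun ω => M N ω ^ 2 + 4 * ∑ k ∈ Finset.range N, M k ω * (x (k + 1) ω - x k ω))
      (g := fun ω => 4 * x N ω ^ 2)
      ((hM' N).sq.add ((BddMeas.sum _ fun k _ => (hM' k).mul ((hx' _).sub (hx' _))).const_mul 4))
      ((hx' N).sq.const_mul 4) (.of_forall fun ω => by
        have := key N ω
        nlinarith [sq_nonneg (M N ω - 2 * x N ω)])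
    rw [BddMeas.integral_add (hM' N).sq
      ((BddMeas.sum _ fun k _ => (hM' k).mul ((hx' _).sub (hx' _))).const_mul 4),
      integral_const_mul, integral_const_mul] at this
    rw [integral_const_mul] at h1
    linarith
  refine ⟨M N, hM' N, ?_, ?_⟩
  · filter_upwards [ae_all_iff.2 fun n => norm_condExp_le (m := 𝒢 n) (μ := μ) h] with ω hω n hn
    exact (hω n).trans (le_partialSups_of_le x hn ω)
  · have := integral_normSq_condExp_le (𝒢.le N) hh.norm
    simp only [norm_norm] at this
    simp only [Real.norm_eq_abs, sq_abs] at this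
    exact h2.trans (by gcongr)

end OneParameter

section Davis

variable {Ω E : Type*} {m0 : MeasurableSpace Ω} {μ : Measure Ω} [IsFiniteMeasure μ]
  [NormedAddCommGroup E] [InnerProductSpace ℝ E] [CompleteSpace E]

theorem norm_sum_smul_sub_le {E : Type*} [NormedAddCommGroup E] [NormedSpace ℝ E] {a : ℕ → ℝ}
    (ha0 : 0 ≤ a 0) (ha : Monotone a) {S : ℕ → E} (h0 : S 0 = 0) {N : ℕ} {G : ℝ}
    (hG : ∀ n ≤ N, ‖S n‖ ≤ G) {n : ℕ} (hn : n ≤ N) :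
    ‖∑ i ∈ Finset.range n, a i • (S (i + 1) - S i)‖ ≤ 2 * a N * G := by
  have abel : ∑ i ∈ Finset.range n, a i • (S (i + 1) - S i) =
      a n • S n - ∑ i ∈ Finset.range n, (a (i + 1) - a i) • S (i + 1) := by
    clear hn
    induction n with
    | zero => simp [h0]
    | succ n ih => rw [Finset.sum_range_succ, ih, Finset.sum_range_succ]; module
  have hG0 : 0 ≤ G := (norm_nonneg _).trans (hG 0 (Nat.zero_le _))
  have h1 : ‖∑ i ∈ Finset.range n, (a (i + 1) - a i) • S (i + 1)‖ ≤ (a n - a 0) * G := by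
    refine (norm_sum_le _ _).trans ?_
    rw [← Finset.sum_range_sub a n, Finset.sum_mul]
    refine Finset.sum_le_sum fun i hi => ?_
    have hi := Finset.mem_range.1 hi
    have : 0 ≤ a (i + 1) - a i := sub_nonneg.2 (ha (Nat.le_succ i))
    rw [norm_smul, Real.norm_of_nonneg this]
    exact mul_le_mul_of_nonneg_left (hG _ (by omega)) this
  have han : 0 ≤ a n := ha0.trans (ha (Nat.zero_le n))
  have h2 : ‖a n • S n‖ ≤ a n * G := by
    rw [norm_smul, Real.norm_of_nonneg han]
    exact mul_le_mul_of_nonneg_left (hG n hn) han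
  have h3 : a n * G ≤ a N * G := mul_le_mul_of_nonneg_right (ha hn) hG0
  have h4 : 0 ≤ a 0 * G := mul_nonneg ha0 hG0
  rw [abel]
  refine (norm_sub_le _ _).trans ?_
  linarith

variable {𝒢 : Filtration ℕ m0} {y : ℕ → Ω → E}

theorem integral_norm_comp_le (hy : ∀ i, BddMeas μ (𝒢 (i + 1)) (y i)) (i : ℕ) :
    ∫ ω, ‖y i ω - (μ[y i|𝒢 i]) ω‖ ∂μ ≤ 2 * ∫ ω, ‖y i ω‖ ∂μ := by
  have h := (hy i).mono (𝒢.le _)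
  have h1 := BddMeas.integral_mono (h.sub (h.condExp' (m := 𝒢 i))).norm
    (h.norm.add (h.condExp' (m := 𝒢 i)).norm) (.of_forall fun ω => norm_sub_le _ _)
  rw [BddMeas.integral_add h.norm h.condExp'.norm] at h1
  linarith [integral_norm_condExp_le (m := 𝒢 i) (μ := μ) (y i)]

/-- A maximal form of Davis' inequality for compensated sums of adapted sequences. -/
theorem davis (hy : ∀ i, BddMeas μ (𝒢 (i + 1)) (y i)) (N : ℕ) :
    ∃ G : Ω → ℝ, BddMeas μ m0 G ∧ (∀ᵐ ω ∂μ, ∀ n ≤ N, ‖compSum 𝒢 μ y n ω‖ ≤ G ω) ∧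
      ∫ ω, G ω ∂μ ≤ 11 * ∫ ω, √(∑ i ∈ Finset.range N, ‖y i ω‖ ^ 2) ∂μ := by
  let W : ℕ → Ω → ℝ := fun n ω => √(∑ i ∈ Finset.range n, ‖y i ω‖ ^ 2)
  let w : ℕ → Ω → ℝ := fun n ω => √(W n ω)
  let t : ℕ → Ω → E := fun i ω => (w (i + 1) ω)⁻¹ • y i ω
  let r : ℕ → Ω → E := fun i ω => (w (i + 1) ω - w i ω) • t i ω
  have hW : ∀ n, BddMeas μ (𝒢 n) (W n) := fun n =>
    (BddMeas.sum _ fun i hi => (hy i).normSq.mono (𝒢.mono (by simpa using hi))).sqrt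
  have hw : ∀ n, BddMeas μ (𝒢 n) (w n) := fun n => (hW n).sqrt
  have hW0 : ∀ n ω, 0 ≤ W n ω := fun n ω => Real.sqrt_nonneg _
  have hw0 : ∀ n ω, 0 ≤ w n ω := fun n ω => Real.sqrt_nonneg _
  have hwsq : ∀ n ω, w n ω ^ 2 = W n ω := fun n ω => Real.sq_sqrt (hW0 n ω)
  have hWs : ∀ n ω, W (n + 1) ω ^ 2 = W n ω ^ 2 + ‖y n ω‖ ^ 2 := by
    intro n ω
    simp only [W]
    rw [Real.sq_sqrt (by positivity), Real.sq_sqrt (by positivity), Finset.sum_range_succ]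
  have hWm : ∀ ω, Monotone (fun n => W n ω) := fun ω => monotone_nat_of_le_succ fun n =>
    Real.sqrt_le_sqrt (by rw [Finset.sum_range_succ]; simp)
  have hwm : ∀ ω, Monotone (fun n => w n ω) := fun ω m n h => Real.sqrt_le_sqrt (hWm ω h)
  have hyW : ∀ n ω, ‖y n ω‖ ≤ W (n + 1) ω := fun n ω => by
    nlinarith [hWs n ω, sq_nonneg (W n ω), hW0 (n + 1) ω, norm_nonneg (y n ω)]
  have hty : ∀ i ω, w (i + 1) ω • t i ω = y i ω := by
    intro i ω
    by_cases h : w (i + 1) ω = 0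
    · have := hwsq (i + 1) ω
      have h2 := hyW i ω
      rw [← this, h] at h2
      have : y i ω = 0 := norm_eq_zero.1 (le_antisymm (by simpa using h2) (norm_nonneg _))
      simp [t, h, this]
    · exact smul_inv_smul₀ h _
  have htw : ∀ i ω, ‖t i ω‖ ≤ w (i + 1) ω := by
    intro i ω
    by_cases h : w (i + 1) ω = 0
    · simp [t, h]
    · have hp : 0 < w (i + 1) ω := lt_of_le_of_ne (hw0 _ _) (Ne.symm h)
      rw [norm_smul, norm_inv, Real.norm_of_nonneg hp.le, inv_mul_le_iff₀ hp, ← pow_two, hwsq]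
      exact hyW i ω
  have htsq : ∀ i ω, ‖t i ω‖ ^ 2 ≤ 2 * (W (i + 1) ω - W i ω) := by
    intro i ω
    by_cases h : w (i + 1) ω = 0
    · have := hWm ω (Nat.le_succ i)
      have h0 : t i ω = 0 := by simp [t, h]
      simp only [Nat.succ_eq_add_one] at this
      rw [h0, norm_zero]
      nlinarith
    · have hp : 0 < w (i + 1) ω := lt_of_le_of_ne (hw0 _ _) (Ne.symm h)
      have h1 := hWs i ω
      have h2 : W (i + 1) ω * ‖t i ω‖ ^ 2 = ‖y i ω‖ ^ 2 := by
        have := norm_smul (w (i + 1) ω) (t i ω)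
        rw [hty, Real.norm_of_nonneg hp.le] at this
        rw [this, mul_pow, hwsq]
      have h3 : 0 < W (i + 1) ω := by rw [← hwsq]; positivity
      have h4 := hWm ω (Nat.le_succ i)
      simp only [Nat.succ_eq_add_one] at h4
      refine le_of_mul_le_mul_left ?_ h3
      nlinarith
  have hrW : ∀ i ω, ‖r i ω‖ ≤ W (i + 1) ω - W i ω := by
    intro i ω
    have h := hwm ω (Nat.le_succ i)
    simp only [Nat.succ_eq_add_one] at h
    rw [norm_smul, Real.norm_of_nonneg (sub_nonneg.2 h), ← hwsq, ← hwsq]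
    nlinarith [htw i ω, hw0 i ω, mul_le_mul_of_nonneg_left (htw i ω) (sub_nonneg.2 h)]
  have ht : ∀ i, BddMeas μ (𝒢 (i + 1)) (t i) := fun i =>
    (hw (i + 1)).of_le ((hw (i + 1)).1.inv₀.smul (hy i).1) (.of_forall fun ω => by
      rw [Real.norm_of_nonneg (hw0 _ _)]; exact htw i ω)
  have hr : ∀ i, BddMeas μ (𝒢 (i + 1)) (r i) := fun i =>
    ((hw (i + 1)).sub ((hw i).mono (𝒢.mono (Nat.le_succ i)))).smul (ht i)
  have hdec : ∀ i, ∀ᵐ ω ∂μ, y i ω - (μ[y i|𝒢 i]) ω =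
      w i ω • (t i ω - (μ[t i|𝒢 i]) ω) + (r i ω - (μ[r i|𝒢 i]) ω) := by
    intro i
    have e : y i = fun ω => w i ω • t i ω + r i ω := by
      ext ω; rw [← hty i ω]; simp only [r]; module
    have ht' := (ht i).mono (𝒢.le _)
    have h1 := BddMeas.condExp_add (m := 𝒢 i) (((hw i).mono (𝒢.le i)).smul ht')
      ((hr i).mono (𝒢.le _))
    rw [← e] at h1
    filter_upwards [h1, (hw i).condExp_smul_left ht' (𝒢.le i)] with ω h1 h2
    rw [h1, h2]
    nth_rw 1 [e]
    module
  obtain ⟨G, hG, hGle, hGint⟩ := doob_sq 𝒢 ((bddMeas_compSum ht N).mono (𝒢.le N)) N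
  have hW' := fun n => (hW n).mono (𝒢.le n)
  have hw' := fun n => (hw n).mono (𝒢.le n)
  have hrc := fun i => ((bddMeas_comp hr i).mono (𝒢.le _)).norm
  have hrs := BddMeas.sum (Finset.range N) fun i _ => hrc i
  refine ⟨fun ω => 2 * w N ω * G ω + ∑ i ∈ Finset.range N, ‖r i ω - (μ[r i|𝒢 i]) ω‖,
    (((hw' N).const_mul 2).mul hG).add hrs, ?_, ?_⟩
  · have hm : ∀ᵐ ω ∂μ, ∀ n, n ≤ N → (μ[compSum 𝒢 μ t N|𝒢 n]) ω = compSum 𝒢 μ t n ω :=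
      ae_all_iff.2 fun n => by
        by_cases hn : n ≤ N
        · filter_upwards [condExp_compSum ht hn] with ω h _ using h
        · exact .of_forall fun ω h => absurd h hn
    filter_upwards [hm, ae_all_iff.2 hdec, hGle] with ω h1 h2 h3 n hn
    have e : compSum 𝒢 μ y n ω = ∑ i ∈ Finset.range n,
        w i ω • (compSum 𝒢 μ t (i + 1) ω - compSum 𝒢 μ t i ω) +
        ∑ i ∈ Finset.range n, (r i ω - (μ[r i|𝒢 i]) ω) := by
      rw [compSum, ← Finset.sum_add_distrib]
      refine Finset.sum_congr rfl fun i _ => ?_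
      rw [h2 i, compSum_succ, add_sub_cancel_left]
    rw [e]
    refine (norm_add_le _ _).trans (add_le_add ?_ ?_)
    · exact norm_sum_smul_sub_le (a := fun i => w i ω) (S := fun i => compSum 𝒢 μ t i ω)
        (hw0 0 ω) (hwm ω) (by simp [compSum])
        (fun k hk => by rw [← h1 k hk]; exact h3 k hk) hn
    · exact (norm_sum_le _ _).trans (Finset.sum_le_sum_of_subset_of_nonneg
        (Finset.range_mono hn) fun i _ _ => norm_nonneg _)
  · have i1 : ∫ ω, 2 * w N ω * G ω ∂μ ≤ ∫ ω, W N ω ∂μ + ∫ ω, G ω ^ 2 ∂μ := by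
      rw [← BddMeas.integral_add (hW' N) hG.sq]
      refine BddMeas.integral_mono (((hw' N).const_mul 2).mul hG) ((hW' N).add hG.sq)
        (.of_forall fun ω => ?_)
      rw [← hwsq]
      nlinarith [sq_nonneg (w N ω - G ω)]
    have tel : ∀ ω, ∑ i ∈ Finset.range N, (W (i + 1) ω - W i ω) = W N ω := fun ω => by
      rw [Finset.sum_range_sub (fun i => W i ω)]; simp [W]
    have i2 : ∑ i ∈ Finset.range N, ∫ ω, ‖t i ω‖ ^ 2 ∂μ ≤ 2 * ∫ ω, W N ω ∂μ := by
      rw [← integral_const_mul, ← BddMeas.integral_sum _ fun i _ => (ht i).normSq.mono (𝒢.le _)]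
      refine BddMeas.integral_mono (BddMeas.sum _ fun i _ => (ht i).normSq.mono (𝒢.le _))
        ((hW' N).const_mul 2) (.of_forall fun ω => ?_)
      rw [← tel ω, Finset.mul_sum]
      exact Finset.sum_le_sum fun i _ => htsq i ω
    have i3 : ∑ i ∈ Finset.range N, ∫ ω, ‖r i ω‖ ∂μ ≤ ∫ ω, W N ω ∂μ := by
      rw [← BddMeas.integral_sum _ fun i _ => (hr i).norm.mono (𝒢.le _)]
      refine BddMeas.integral_mono (BddMeas.sum _ fun i _ => (hr i).norm.mono (𝒢.le _))
        (hW' N) (.of_forall fun ω => ?_)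
      rw [← tel ω]
      exact Finset.sum_le_sum fun i _ => hrW i ω
    have i4 : ∑ i ∈ Finset.range N, ∫ ω, ‖r i ω - (μ[r i|𝒢 i]) ω‖ ∂μ ≤ 2 * ∫ ω, W N ω ∂μ := by
      refine le_trans (Finset.sum_le_sum fun i _ => integral_norm_comp_le hr i) ?_
      rw [← Finset.mul_sum]
      linarith
    rw [BddMeas.integral_add (((hw' N).const_mul 2).mul hG) hrs,
      BddMeas.integral_sum _ fun i _ => hrc i]
    have i5 := integral_normSq_compSum_le ht N
    change _ ≤ 11 * ∫ ω, W N ω ∂μ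
    linarith

end Davis

/-- Two filtrations `R` (rows) and `C` (columns) whose conditional expectations commute, with
composition given by the conditional expectation on `F i j`. -/
structure IsCommutingGrid {Ω : Type*} {m0 : MeasurableSpace Ω} (μ : Measure Ω)
    (R C : Filtration ℕ m0) (F : ℕ → ℕ → MeasurableSpace Ω) : Prop where
  le_row : ∀ i j, F i j ≤ R i
  le_col : ∀ i j, F i j ≤ C j
  mono : ∀ {i k j l}, i ≤ k → j ≤ l → F i j ≤ F k l
  row_col : ∀ i j (f : Ω → ℝ), Integrable f μ → μ[μ[f|C j]|R i] =ᵐ[μ] μ[f|F i j]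
  col_row : ∀ i j (f : Ω → ℝ), Integrable f μ → μ[μ[f|R i]|C j] =ᵐ[μ] μ[f|F i j]

/-- The rectangular increment `(1 - 𝔼[· | R_i])(1 - 𝔼[· | C_j]) y`. -/
noncomputable def rectInc {Ω : Type*} {m0 : MeasurableSpace Ω} (μ : Measure Ω)
    (R C : Filtration ℕ m0) (F : ℕ → ℕ → MeasurableSpace Ω) (i j : ℕ) (y : Ω → ℝ) (ω : Ω) : ℝ :=
  (y ω - (μ[y|C j]) ω) - ((μ[y|R i]) ω - (μ[y|F i j]) ω)

/-- The rectangular sums of the increments `rectInc`. -/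
noncomputable def rectSum {Ω : Type*} {m0 : MeasurableSpace Ω} (μ : Measure Ω)
    (R C : Filtration ℕ m0) (F : ℕ → ℕ → MeasurableSpace Ω) (y : ℕ → ℕ → Ω → ℝ) (n m : ℕ)
    (ω : Ω) : ℝ :=
  ∑ i ∈ Finset.range n, ∑ j ∈ Finset.range m, rectInc μ R C F i j (y i j) ω

/-- The square function of an `N × N` array. -/
noncomputable def sqFun {Ω : Type*} (y : ℕ → ℕ → Ω → ℝ) (N : ℕ) (ω : Ω) : ℝ :=
  √(∑ i ∈ Finset.range N, ∑ j ∈ Finset.range N, y i j ω ^ 2)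

namespace IsCommutingGrid

variable {Ω : Type*} {m0 : MeasurableSpace Ω} {μ : Measure Ω} {R C : Filtration ℕ m0}
  {F : ℕ → ℕ → MeasurableSpace Ω}

theorem symm (h : IsCommutingGrid μ R C F) : IsCommutingGrid μ C R (fun j i => F i j) :=
  ⟨fun i j => h.le_col j i, fun i j => h.le_row j i, fun h1 h2 => h.mono h2 h1,
    fun i j => h.col_row j i, fun i j => h.row_col j i⟩

theorem le (h : IsCommutingGrid μ R C F) (i j : ℕ) : F i j ≤ m0 := (h.le_row i j).trans (R.le i)

theorem rectInc_symm (i j : ℕ) (y : Ω → ℝ) :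
    rectInc μ C R (fun j i => F i j) j i y = rectInc μ R C F i j y := by
  ext ω; simp only [rectInc]; ring

theorem bddMeas_sqFun {y : ℕ → ℕ → Ω → ℝ} (hy : ∀ i j, BddMeas μ m0 (y i j)) (N : ℕ) :
    BddMeas μ m0 (sqFun y N) :=
  (BddMeas.sum _ fun i _ => BddMeas.sum _ fun j _ => (hy i j).sq).sqrt

variable [IsFiniteMeasure μ]

theorem condExp_col_eq (h : IsCommutingGrid μ R C F) {k l : ℕ} {y : Ω → ℝ}
    (hy : BddMeas μ (F k l) y) (j : ℕ) : μ[y|C j] =ᵐ[μ] μ[y|F k j] :=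
  (condExp_congr_ae ((hy.mono (h.le_row k l)).condExp_eq (R.le k)).symm).trans
    (h.col_row k j y (hy.mono (h.le k l)).integrable)

theorem condExp_row_eq (h : IsCommutingGrid μ R C F) {k l : ℕ} {y : Ω → ℝ}
    (hy : BddMeas μ (F k l) y) (i : ℕ) : μ[y|R i] =ᵐ[μ] μ[y|F i l] :=
  h.symm.condExp_col_eq (k := l) (l := k) hy i

theorem bddMeas_col (h : IsCommutingGrid μ R C F) {k l : ℕ} {y : Ω → ℝ}
    (hy : BddMeas μ (F k l) y) (j : ℕ) : BddMeas μ (F k j) (μ[y|C j]) :=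
  ((hy.mono (h.le k l)).condExp (m := F k j)).congr (h.condExp_col_eq hy j).symm

theorem bddMeas_row (h : IsCommutingGrid μ R C F) {k l : ℕ} {y : Ω → ℝ}
    (hy : BddMeas μ (F k l) y) (i : ℕ) : BddMeas μ (F i l) (μ[y|R i]) :=
  h.symm.bddMeas_col (k := l) (l := k) hy i

theorem bddMeas_rectInc (h : IsCommutingGrid μ R C F) {i j : ℕ} {y : Ω → ℝ}
    (hy : BddMeas μ (F (i + 1) (j + 1)) y) :
    BddMeas μ (F (i + 1) (j + 1)) (rectInc μ R C F i j y) :=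
  (hy.sub ((h.bddMeas_col hy j).mono (h.mono le_rfl j.le_succ))).sub
    (((h.bddMeas_row hy i).mono (h.mono i.le_succ le_rfl)).sub
      (BddMeas.mono ((hy.mono (h.le _ _)).condExp (m := F i j)) (h.mono i.le_succ j.le_succ)))

theorem rectInc_ae_eq (h : IsCommutingGrid μ R C F) {y : Ω → ℝ} (hy : BddMeas μ m0 y) (i j : ℕ) :
    rectInc μ R C F i j y =ᵐ[μ] fun ω => (y ω - (μ[y|C j]) ω) -
      (μ[fun ω => y ω - (μ[y|C j]) ω|R i]) ω := by
  filter_upwards [BddMeas.condExp_sub (m := R i) hy (hy.condExp' (m := C j)),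
    h.row_col i j y hy.integrable] with ω h1 h2
  rw [rectInc, h1, h2]

theorem condExp_row_rectInc (h : IsCommutingGrid μ R C F) {y : Ω → ℝ} (hy : BddMeas μ m0 y)
    {i n : ℕ} (hn : n ≤ i) (j : ℕ) : μ[rectInc μ R C F i j y|R n] =ᵐ[μ] fun _ => 0 := by
  have hD := hy.sub (hy.condExp' (m := C j))
  filter_upwards [condExp_congr_ae (m := R n) (h.rectInc_ae_eq hy i j),
    BddMeas.condExp_sub (m := R n) hD (hD.condExp' (m := R i)),
    condExp_condExp_of_le (μ := μ) (f := fun ω => y ω - (μ[y|C j]) ω) (R.mono hn) (R.le i)]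
    with ω h1 h2 h3
  rw [h1, h2, h3, sub_self]

theorem condExp_rectInc (h : IsCommutingGrid μ R C F) {i j : ℕ} {y : Ω → ℝ}
    (hy : BddMeas μ (F (i + 1) (j + 1)) y) (n m : ℕ) :
    μ[rectInc μ R C F i j y|F n m] =ᵐ[μ]
      fun ω => if i < n ∧ j < m then rectInc μ R C F i j y ω else 0 := by
  have hI := h.bddMeas_rectInc hy
  have hy0 := hy.mono (h.le _ _)
  have hI0 := (hI.mono (h.le _ _)).integrable
  by_cases hn : i < n
  · by_cases hm : j < m
    · simp only [hn, hm, and_self, if_true]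
      exact (hI.mono (h.mono hn hm)).condExp_eq (h.le _ _)
    · simp only [hm, and_false, if_false]
      have h1 := h.symm.condExp_row_rectInc hy0 (not_lt.1 hm) i
      rw [rectInc_symm] at h1
      refine (h.row_col n m _ hI0).symm.trans ((condExp_congr_ae h1).trans ?_)
      exact .of_eq (condExp_const (R.le n) 0)
  · simp only [hn, false_and, if_false]
    refine (h.col_row n m _ hI0).symm.trans
      ((condExp_congr_ae (h.condExp_row_rectInc hy0 (not_lt.1 hn) j)).trans ?_)
    exact .of_eq (condExp_const (C.le m) 0)

section Array

variable {y : ℕ → ℕ → Ω → ℝ}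

theorem bddMeas_rectSum (h : IsCommutingGrid μ R C F)
    (hy : ∀ i j, BddMeas μ (F (i + 1) (j + 1)) (y i j)) (n m : ℕ) :
    BddMeas μ m0 (rectSum μ R C F y n m) :=
  BddMeas.sum _ fun i _ => BddMeas.sum _ fun j _ => (h.bddMeas_rectInc (hy i j)).mono (h.le _ _)

theorem condExp_rectSum (h : IsCommutingGrid μ R C F)
    (hy : ∀ i j, BddMeas μ (F (i + 1) (j + 1)) (y i j)) {n m N : ℕ} (hn : n ≤ N) (hm : m ≤ N) :
    μ[rectSum μ R C F y N N|F n m] =ᵐ[μ] rectSum μ R C F y n m := by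
  have hI := fun i j => (h.bddMeas_rectInc (hy i j)).mono (h.le _ _)
  have h1 := BddMeas.condExp_sum (m := F n m) (Finset.range N)
    fun i _ => BddMeas.sum (Finset.range N) fun j _ => hI i j
  have h2 := fun i => BddMeas.condExp_sum (m := F n m) (Finset.range N) fun j _ => hI i j
  filter_upwards [h1, ae_all_iff.2 h2,
    ae_all_iff.2 fun i => ae_all_iff.2 fun j => h.condExp_rectInc (hy i j) n m] with ω h1 h2 h3
  refine h1.trans ?_
  simp only [h2, h3, rectSum]
  have e : ∀ i j, (if i < n ∧ j < m then rectInc μ R C F i j (y i j) ω else 0) =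
      if i < n then (if j < m then rectInc μ R C F i j (y i j) ω else 0) else 0 := by
    intro i j; split_ifs <;> simp_all
  simp only [e]
  have e2 : ∀ {k} (_ : k ≤ N) (g : ℕ → ℝ), ∑ i ∈ Finset.range N, (if i < k then g i else 0) =
      ∑ i ∈ Finset.range k, g i := by
    intro k hk g
    rw [← Finset.sum_filter]
    congr 1
    ext i
    simp only [Finset.mem_filter, Finset.mem_range]
    omega
  have e3 : ∀ i, ∑ j ∈ Finset.range N,
      (if i < n then (if j < m then rectInc μ R C F i j (y i j) ω else 0) else 0) =
      if i < n then ∑ j ∈ Finset.range m, rectInc μ R C F i j (y i j) ω else 0 := by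
    intro i
    split_ifs
    · exact e2 hm _
    · simp
  simp only [e3]
  exact e2 hn _

theorem rectSum_ae_eq_compSum (h : IsCommutingGrid μ R C F)
    (hy : ∀ i j, BddMeas μ (F (i + 1) (j + 1)) (y i j)) (N : ℕ) :
    rectSum μ R C F y N N =ᵐ[μ] compSum R μ (fun i => compSum C μ (y i) N) N := by
  have hy0 := fun i j => (hy i j).mono (h.le _ _)
  have hD := fun i j => (hy0 i j).sub ((hy0 i j).condExp' (m := C j))
  filter_upwards [ae_all_iff.2 fun i => ae_all_iff.2 fun j => h.rectInc_ae_eq (hy0 i j) i j,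
    ae_all_iff.2 fun i => BddMeas.condExp_sum (m := R i) (Finset.range N)
      fun j _ => hD i j] with ω h1 h2
  simp only [rectSum]
  rw [compSum]
  refine Finset.sum_congr rfl fun i _ => ?_
  simp only [h1, Finset.sum_sub_distrib]
  congr 1
  · simp only [compSum, Finset.sum_sub_distrib]
  · exact (h2 i).symm

theorem bddMeas_compSum_col (h : IsCommutingGrid μ R C F)
    (hy : ∀ i j, BddMeas μ (F (i + 1) (j + 1)) (y i j)) (N i : ℕ) :
    BddMeas μ (R (i + 1)) (compSum C μ (y i) N) :=
  BddMeas.sum _ fun j _ => ((hy i j).mono (h.le_row _ _)).sub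
    ((h.bddMeas_col (hy i j) j).mono (h.le_row _ _))

theorem integral_sq_rectSum_le (h : IsCommutingGrid μ R C F)
    (hy : ∀ i j, BddMeas μ (F (i + 1) (j + 1)) (y i j)) (N : ℕ) :
    ∫ ω, rectSum μ R C F y N N ω ^ 2 ∂μ ≤
      ∑ i ∈ Finset.range N, ∑ j ∈ Finset.range N, ∫ ω, y i j ω ^ 2 ∂μ := by
  have h1 := integral_normSq_compSum_le (h.bddMeas_compSum_col hy N) N
  have h2 := fun i => integral_normSq_compSum_le (fun j => (hy i j).mono (h.le_col _ _)) N
  simp only [Real.norm_eq_abs, sq_abs] at h1 h2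
  have e : ∫ ω, rectSum μ R C F y N N ω ^ 2 ∂μ =
      ∫ ω, compSum R μ (fun i => compSum C μ (y i) N) N ω ^ 2 ∂μ :=
    integral_congr_ae ((h.rectSum_ae_eq_compSum hy N).fun_comp (· ^ 2))
  rw [e]
  exact h1.trans (Finset.sum_le_sum fun i _ => h2 i)

/-- The two-parameter Doob `L²` maximal inequality. -/
theorem doob_sq (h : IsCommutingGrid μ R C F) {f : Ω → ℝ} (hf : BddMeas μ m0 f) (N : ℕ) :
    ∃ G : Ω → ℝ, BddMeas μ m0 G ∧
      (∀ᵐ ω ∂μ, ∀ n ≤ N, ∀ m ≤ N, |(μ[f|F n m]) ω| ≤ G ω) ∧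
      ∫ ω, G ω ^ 2 ∂μ ≤ 16 * ∫ ω, f ω ^ 2 ∂μ := by
  obtain ⟨G₁, hG₁, hle₁, hi₁⟩ := _root_.doob_sq C hf N
  obtain ⟨G, hG, hle, hi⟩ := _root_.doob_sq R hG₁ N
  refine ⟨G, hG, ?_, ?_⟩
  · have key : ∀ n m, ∀ᵐ ω ∂μ, m ≤ N → |(μ[f|F n m]) ω| ≤ (μ[G₁|R n]) ω := by
      intro n m
      by_cases hm : m ≤ N
      · have h1 : ∀ᵐ ω ∂μ, ‖(μ[f|C m]) ω‖ ≤ G₁ ω := by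
          filter_upwards [hle₁] with ω h using h m hm
        filter_upwards [h.row_col n m f hf.integrable,
          norm_condExp_le (m := R n) (μ := μ) (μ[f|C m]),
          condExp_mono (m := R n) (hf.condExp' (m := C m)).norm.integrable hG₁.integrable h1]
          with ω h2 h3 h4 _
        rw [← h2]
        exact h3.trans h4
      · exact .of_forall fun ω hm' => absurd hm' hm
    filter_upwards [hle, ae_all_iff.2 fun n => ae_all_iff.2 fun m => key n m] with ω h1 h2 n hn m hm
    exact (h2 n m hm).trans ((le_abs_self _).trans (h1 n hn))
  · simp only [Real.norm_eq_abs, sq_abs] at hi hi₁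
    linarith

theorem exists_dom_rectSum (h : IsCommutingGrid μ R C F)
    (hy : ∀ i j, BddMeas μ (F (i + 1) (j + 1)) (y i j)) (N : ℕ) :
    ∃ G : Ω → ℝ, BddMeas μ m0 G ∧
      (∀ᵐ ω ∂μ, ∀ n ≤ N, ∀ m ≤ N, |rectSum μ R C F y n m ω| ≤ G ω) ∧
      ∫ ω, G ω ^ 2 ∂μ ≤
        16 * ∑ i ∈ Finset.range N, ∑ j ∈ Finset.range N, ∫ ω, y i j ω ^ 2 ∂μ := by
  obtain ⟨G, hG, hle, hi⟩ := h.doob_sq (h.bddMeas_rectSum hy N N) N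
  refine ⟨G, hG, ?_, hi.trans (by gcongr; exact h.integral_sq_rectSum_le hy N)⟩
  have h1 : ∀ n m, ∀ᵐ ω ∂μ, n ≤ N → m ≤ N →
      (μ[rectSum μ R C F y N N|F n m]) ω = rectSum μ R C F y n m ω := by
    intro n m
    by_cases hnm : n ≤ N ∧ m ≤ N
    · filter_upwards [h.condExp_rectSum hy hnm.1 hnm.2] with ω h _ _ using h
    · exact .of_forall fun ω hn hm => absurd ⟨hn, hm⟩ hnm
  filter_upwards [hle, ae_all_iff.2 fun n => ae_all_iff.2 fun m => h1 n m] with ω h2 h3 n hn m hm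
  rw [← h3 n m hn hm]
  exact h2 n hn m hm

theorem integral_abs_rectSum_le (h : IsCommutingGrid μ R C F)
    (hy : ∀ i j, BddMeas μ (F (i + 1) (j + 1)) (y i j)) (N : ℕ) :
    ∫ ω, |rectSum μ R C F y N N ω| ∂μ ≤ 121 * ∫ ω, sqFun y N ω ∂μ := by
  let v : ℕ → Ω → EuclideanSpace ℝ (Fin N) := fun j ω => WithLp.toLp 2 fun i => y i j ω
  have hv : ∀ j, BddMeas μ (C (j + 1)) (v j) := by
    intro j
    have hs : BddMeas μ (C (j + 1)) (fun ω => ∑ i : Fin N,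
        y i j ω • (EuclideanSpace.single i (1 : ℝ) : EuclideanSpace ℝ (Fin N))) :=
      BddMeas.sum _ fun i _ => ((hy i j).mono (h.le_col _ _)).smul (BddMeas.const _)
    refine hs.congr (.of_forall fun ω => ?_)
    ext k
    simp [v, Pi.single_apply]
  have hcoord : ∀ᵐ ω ∂μ, ∀ j, ∀ i : Fin N, (μ[v j|C j]) ω i = (μ[y i j|C j]) ω := by
    refine ae_all_iff.2 fun j => ae_all_iff.2 fun i => ?_
    have := (EuclideanSpace.proj (𝕜 := ℝ) i :
      EuclideanSpace ℝ (Fin N) →L[ℝ] ℝ).comp_condExp_comm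
      (m := C j) ((hv j).mono (C.le _)).integrable
    exact this
  obtain ⟨G, hG, hle, hi⟩ := davis (h.bddMeas_compSum_col hy N) N
  obtain ⟨G', hG', hle', hi'⟩ := davis hv N
  have hnv : ∀ ω, √(∑ j ∈ Finset.range N, ‖v j ω‖ ^ 2) = sqFun y N ω := by
    intro ω
    rw [sqFun, Finset.sum_comm]
    congr 1
    refine Finset.sum_congr rfl fun j _ => ?_
    rw [EuclideanSpace.norm_sq_eq, Finset.sum_range]
    simp [v]
  have hY : ∀ᵐ ω ∂μ, √(∑ i ∈ Finset.range N, ‖compSum C μ (y i) N ω‖ ^ 2) ≤ G' ω := by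
    filter_upwards [hcoord, hle'] with ω h1 h2
    refine le_trans (le_of_eq ?_) (h2 N le_rfl)
    rw [EuclideanSpace.norm_eq, Finset.sum_range]
    congr 1
    refine Finset.sum_congr rfl fun i _ => ?_
    congr 2
    simp [compSum, h1, v]
  have hcs := fun i => (h.bddMeas_compSum_col hy N i).mono (R.le _)
  have e1 : ∫ ω, |rectSum μ R C F y N N ω| ∂μ ≤ ∫ ω, G ω ∂μ := by
    refine BddMeas.integral_mono (h.bddMeas_rectSum hy N N).abs hG ?_
    filter_upwards [h.rectSum_ae_eq_compSum hy N, hle] with ω h1 h2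
    rw [h1]
    exact h2 N le_rfl
  have e2 := BddMeas.integral_mono (BddMeas.sum (Finset.range N)
    fun i _ => (hcs i).normSq).sqrt hG' hY
  simp only [hnv] at hi'
  linarith

end Array

end IsCommutingGrid

theorem BddMeas.integral_le_two_mul_compl {Ω : Type*} {m m0 : MeasurableSpace Ω} {μ : Measure Ω}
    [IsFiniteMeasure μ] {u : Ω → ℝ} (hu : BddMeas μ m u) (hm : m ≤ m0) (hu0 : ∀ ω, 0 ≤ u ω)
    {H : Set Ω} (hH : MeasurableSet[m0] H)
    (hc : ∀ᵐ ω ∂μ, u ω ≠ 0 → (μ[H.indicator fun _ => (1 : ℝ)|m]) ω ≤ 1 / 2) :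
    ∫ ω, u ω ∂μ ≤ 2 * ∫ ω, Hᶜ.indicator u ω ∂μ := by
  have h1 : BddMeas μ m0 (H.indicator fun _ => (1 : ℝ)) := (BddMeas.const 1).indicator hH
  have hu' := hu.mono hm
  have e : ∫ ω, u ω ∂μ = ∫ ω, u ω * H.indicator (fun _ => (1 : ℝ)) ω ∂μ +
      ∫ ω, Hᶜ.indicator u ω ∂μ := by
    rw [← BddMeas.integral_add (hu'.mul h1) (hu'.indicator hH.compl)]
    refine integral_congr_ae (.of_forall fun ω => ?_)
    by_cases hω : ω ∈ H <;> simp [hω]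
  have e2 : ∫ ω, u ω * H.indicator (fun _ => (1 : ℝ)) ω ∂μ ≤ 1 / 2 * ∫ ω, u ω ∂μ := by
    rw [← hu.integral_mul_condExp h1 hm, ← integral_const_mul]
    refine BddMeas.integral_mono (hu'.mul h1.condExp') (hu'.const_mul _) ?_
    filter_upwards [hc] with ω hω
    by_cases h0 : u ω = 0
    · simp [h0]
    · nlinarith [hω h0, hu0 ω]
  linarith

/-- The double sums of `𝔼[(1 - 𝔼[· | R_i]) z_{ij} | C_j]`. -/
noncomputable def mixSum {Ω : Type*} {m0 : MeasurableSpace Ω} (μ : Measure Ω)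
    (R C : Filtration ℕ m0) (z : ℕ → ℕ → Ω → ℝ) (n m : ℕ) (ω : Ω) : ℝ :=
  ∑ i ∈ Finset.range n, ∑ j ∈ Finset.range m,
    (μ[fun ω => z i j ω - (μ[z i j|R i]) ω|C j]) ω

theorem sqFun_symm {Ω : Type*} (z : ℕ → ℕ → Ω → ℝ) (N : ℕ) :
    sqFun (fun j i => z i j) N = sqFun z N := by
  ext ω; simp only [sqFun]; rw [Finset.sum_comm]

theorem sqFun_mono {Ω : Type*} {y z : ℕ → ℕ → Ω → ℝ} {N : ℕ} {ω : Ω}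
    (h : ∀ i j, |z i j ω| ≤ |y i j ω|) : sqFun z N ω ≤ sqFun y N ω :=
  Real.sqrt_le_sqrt <| Finset.sum_le_sum fun i _ => Finset.sum_le_sum fun j _ =>
    sq_le_sq.2 (h i j)

namespace IsCommutingGrid

variable {Ω : Type*} {m0 : MeasurableSpace Ω} {μ : Measure Ω} {R C : Filtration ℕ m0}
  {F : ℕ → ℕ → MeasurableSpace Ω} [IsFiniteMeasure μ]

/-- If the column square functions live on small sets, then the expectation of their sum is
controlled by the expectation of the full square function. -/
theorem sum_integral_colSqrt_le (h : IsCommutingGrid μ R C F) {z : ℕ → ℕ → Ω → ℝ}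
    (hz : ∀ i j, BddMeas μ (F (i + 1) (j + 1)) (z i j)) {H : ℕ → Set Ω}
    (hH : ∀ j, MeasurableSet[C j] (H j)) {N : ℕ}
    (hsub : ∀ i j l ω, i < N → j < l → l < N → z i j ω ≠ 0 → ω ∈ H l)
    (hc : ∀ i j, i < N → j < N → ∀ᵐ ω ∂μ, z i j ω ≠ 0 →
      (μ[(H j).indicator fun _ => (1 : ℝ)|F (i + 1) j]) ω ≤ 1 / 2) :
    ∑ j ∈ Finset.range N, ∫ ω, √(∑ i ∈ Finset.range N, z i j ω ^ 2) ∂μ ≤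
      2 * ∫ ω, sqFun z N ω ∂μ := by
  let V : ℕ → ℕ → Ω → ℝ := fun n j ω => √(∑ i ∈ Finset.range n, z i j ω ^ 2)
  have hVm : ∀ n j, BddMeas μ (F n (j + 1)) (V n j) := fun n j =>
    (BddMeas.sum _ fun i hi => ((hz i j).mono (h.mono (Finset.mem_range.1 hi) le_rfl)).sq).sqrt
  have hV0 : ∀ n j, BddMeas μ m0 (V n j) := fun n j => (hVm n j).mono (h.le _ _)
  have hH0 : ∀ j, MeasurableSet[m0] (H j) := fun j => C.le j _ (hH j)
  have hinc : ∀ i j, i < N → j < N → ∫ ω, (V (i + 1) j ω - V i j ω) ∂μ ≤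
      2 * ∫ ω, (H j)ᶜ.indicator (fun ω => V (i + 1) j ω - V i j ω) ω ∂μ := by
    intro i j hi hj
    refine BddMeas.integral_le_two_mul_compl (m := F (i + 1) (j + 1))
      ((hVm (i + 1) j).sub ((hVm i j).mono (h.mono i.le_succ le_rfl))) (h.le _ _) (fun ω => ?_)
      (hH0 j) ?_
    · refine sub_nonneg.2 (Real.sqrt_le_sqrt ?_)
      rw [Finset.sum_range_succ]
      nlinarith [sq_nonneg (z i j ω)]
    · have hb : BddMeas μ (C j) ((H j).indicator fun _ => (1 : ℝ)) :=
        (BddMeas.const 1).indicator (hH j)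
      have hb0 := hb.mono (C.le j)
      have e1 := h.row_col (i + 1) j _ hb0.integrable
      have e2 := h.row_col (i + 1) (j + 1) _ hb0.integrable
      have e3 := condExp_congr_ae (m := R (i + 1)) (hb.condExp_eq (C.le j))
      have e4 := condExp_congr_ae (m := R (i + 1))
        ((hb.mono (C.mono j.le_succ)).condExp_eq (C.le (j + 1)))
      filter_upwards [hc i j hi hj, e1, e2, e3, e4] with ω h1 e1 e2 e3 e4 hne
      rw [← e2, e4, ← e3, e1]
      refine h1 fun h0 => hne ?_
      simp [V, Finset.sum_range_succ, h0]
  have htel : ∀ j ω, ∑ i ∈ Finset.range N, (V (i + 1) j ω - V i j ω) = V N j ω := by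
    intro j ω
    rw [Finset.sum_range_sub (fun i => V i j ω)]
    simp [V]
  have hcol : ∀ j, j < N → ∫ ω, V N j ω ∂μ ≤ 2 * ∫ ω, (H j)ᶜ.indicator (V N j) ω ∂μ := by
    intro j hj
    have e1 : ∫ ω, V N j ω ∂μ = ∑ i ∈ Finset.range N, ∫ ω, (V (i + 1) j ω - V i j ω) ∂μ := by
      rw [← BddMeas.integral_sum _ fun i _ => (hV0 (i + 1) j).sub (hV0 i j)]
      simp only [htel]
    have e2 : ∫ ω, (H j)ᶜ.indicator (V N j) ω ∂μ = ∑ i ∈ Finset.range N,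
        ∫ ω, (H j)ᶜ.indicator (fun ω => V (i + 1) j ω - V i j ω) ω ∂μ := by
      rw [← BddMeas.integral_sum _
        fun i _ => ((hV0 (i + 1) j).sub (hV0 i j)).indicator (hH0 j).compl]
      refine integral_congr_ae (.of_forall fun ω => ?_)
      by_cases hω : ω ∈ H j
      · simp [hω]
      · simp only [Set.mem_compl_iff, hω, not_false_eq_true, Set.indicator_of_mem]
        exact (htel j ω).symm
    rw [e1, e2, Finset.mul_sum]
    exact Finset.sum_le_sum fun i hi => hinc i j (Finset.mem_range.1 hi) hj
  have hpt : ∀ ω, ∑ j ∈ Finset.range N, (H j)ᶜ.indicator (V N j) ω ≤ sqFun z N ω := by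
    intro ω
    by_cases hall : ∀ j ∈ Finset.range N, (H j)ᶜ.indicator (V N j) ω = 0
    · rw [Finset.sum_eq_zero hall]; exact Real.sqrt_nonneg _
    push Not at hall
    obtain ⟨j, hj, hne⟩ := hall
    have key : ∀ k l, k < l → l < N → (H k)ᶜ.indicator (V N k) ω ≠ 0 →
        (H l)ᶜ.indicator (V N l) ω ≠ 0 → False := by
      intro k l hkl hl hk hl'
      have h1 : ω ∉ H l := fun hm => hl' (by simp [hm])
      have h2 : V N k ω ≠ 0 := fun hm => hk (Set.indicator_apply_eq_zero.2 fun _ => hm)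
      have h3 : ∃ i ∈ Finset.range N, z i k ω ≠ 0 := by
        by_contra! hcon
        exact h2 (by
          simp only [V]
          rw [Finset.sum_eq_zero fun i hi => by rw [hcon i hi]; ring]
          simp)
      obtain ⟨i, hi, hz0⟩ := h3
      exact h1 (hsub i k l ω (Finset.mem_range.1 hi) hkl hl hz0)
    rw [Finset.sum_eq_single j]
    · refine (Set.indicator_le_self' (fun ω _ => Real.sqrt_nonneg _) ω).trans
        (Real.sqrt_le_sqrt ?_)
      exact Finset.sum_le_sum fun i _ => Finset.single_le_sum (f := fun j => z i j ω ^ 2)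
        (fun j _ => sq_nonneg _) hj
    · intro k hk hkj
      by_contra hk0
      rcases lt_or_gt_of_ne hkj with hlt | hlt
      · exact key k j hlt (Finset.mem_range.1 hj) hk0 hne
      · exact key j k hlt (Finset.mem_range.1 hk) hne hk0
    · exact fun hj' => absurd hj hj'
  have hz0 := fun i j => (hz i j).mono (h.le _ _)
  calc ∑ j ∈ Finset.range N, ∫ ω, V N j ω ∂μ
      ≤ ∑ j ∈ Finset.range N, 2 * ∫ ω, (H j)ᶜ.indicator (V N j) ω ∂μ :=
        Finset.sum_le_sum fun j hj => hcol j (Finset.mem_range.1 hj)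
    _ = 2 * ∫ ω, ∑ j ∈ Finset.range N, (H j)ᶜ.indicator (V N j) ω ∂μ := by
        rw [BddMeas.integral_sum _ fun j _ => (hV0 N j).indicator (hH0 j).compl, Finset.mul_sum]
    _ ≤ 2 * ∫ ω, sqFun z N ω ∂μ := by
        refine mul_le_mul_of_nonneg_left (BddMeas.integral_mono
          (BddMeas.sum _ fun j _ => (hV0 N j).indicator (hH0 j).compl) (bddMeas_sqFun hz0 N)
          (.of_forall hpt)) zero_le_two

theorem exists_dom_mixSum (h : IsCommutingGrid μ R C F) {z : ℕ → ℕ → Ω → ℝ}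
    (hz : ∀ i j, BddMeas μ (F (i + 1) (j + 1)) (z i j)) {H : ℕ → Set Ω}
    (hH : ∀ j, MeasurableSet[C j] (H j)) {N : ℕ}
    (hsub : ∀ i j l ω, i < N → j < l → l < N → z i j ω ≠ 0 → ω ∈ H l)
    (hc : ∀ i j, i < N → j < N → ∀ᵐ ω ∂μ, z i j ω ≠ 0 →
      (μ[(H j).indicator fun _ => (1 : ℝ)|F (i + 1) j]) ω ≤ 1 / 2) :
    ∃ G : Ω → ℝ, BddMeas μ m0 G ∧
      (∀ᵐ ω ∂μ, ∀ n ≤ N, ∀ m ≤ N, |mixSum μ R C z n m ω| ≤ G ω) ∧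
      ∫ ω, G ω ∂μ ≤ 22 * ∫ ω, sqFun z N ω ∂μ := by
  have hz0 := fun i j => (hz i j).mono (h.le _ _)
  have hD := fun i j => (hz0 i j).sub ((hz0 i j).condExp' (m := R i))
  choose G hG hle hi using fun j => davis (fun i => (hz i j).mono (h.le_row (i + 1) (j + 1))) N
  refine ⟨fun ω => ∑ j ∈ Finset.range N, (μ[G j|C j]) ω,
    BddMeas.sum _ fun j _ => (hG j).condExp', ?_, ?_⟩
  · have key : ∀ j n, ∀ᵐ ω ∂μ, n ≤ N →
        |∑ i ∈ Finset.range n, (μ[fun ω => z i j ω - (μ[z i j|R i]) ω|C j]) ω| ≤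
          (μ[G j|C j]) ω := by
      intro j n
      by_cases hn : n ≤ N
      · have hcm : BddMeas μ m0 (compSum R μ (fun i => z i j) n) := BddMeas.sum _ fun i _ => hD i j
        have h1 : ∀ᵐ ω ∂μ, ‖compSum R μ (fun i => z i j) n ω‖ ≤ G j ω := by
          filter_upwards [hle j] with ω h using h n hn
        filter_upwards [norm_condExp_le (m := C j) (μ := μ) (compSum R μ (fun i => z i j) n),
          condExp_mono (m := C j) hcm.norm.integrable (hG j).integrable h1,
          BddMeas.condExp_sum (m := C j) (Finset.range n) fun i _ => hD i j] with ω h2 h3 h4 _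
        rw [← h4]
        exact h2.trans h3
      · exact .of_forall fun ω hn' => absurd hn' hn
    have hG0 : ∀ j, ∀ᵐ ω ∂μ, 0 ≤ (μ[G j|C j]) ω := fun j => by
      filter_upwards [key j 0] with ω hω using (abs_nonneg _).trans (hω (Nat.zero_le _))
    filter_upwards [ae_all_iff.2 fun j => ae_all_iff.2 fun n => key j n, ae_all_iff.2 hG0]
      with ω h1 h2 n hn m hm
    rw [mixSum, Finset.sum_comm]
    refine (Finset.abs_sum_le_sum_abs _ _).trans
      ((Finset.sum_le_sum fun j _ => h1 j n hn).trans ?_)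
    exact Finset.sum_le_sum_of_subset_of_nonneg (Finset.range_mono hm) fun j _ _ => h2 j
  · rw [BddMeas.integral_sum _ fun j _ => (hG j).condExp']
    have h1 := h.sum_integral_colSqrt_le hz hH hsub hc
    have h2 : ∑ j ∈ Finset.range N, ∫ ω, (μ[G j|C j]) ω ∂μ ≤
        ∑ j ∈ Finset.range N, 11 * ∫ ω, √(∑ i ∈ Finset.range N, z i j ω ^ 2) ∂μ := by
      refine Finset.sum_le_sum fun j _ => ?_
      rw [integral_condExp (C.le j)]
      have := hi j
      simpa only [Real.norm_eq_abs, sq_abs] using this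
    rw [← Finset.mul_sum] at h2
    linarith

/-- Off a set `O` on which `y` lives, `rectInc y` splits into conditional expectations on `F i j`
and one-parameter compensated terms. -/
theorem rectInc_eq_off (h : IsCommutingGrid μ R C F) {y : Ω → ℝ} (hy : BddMeas μ m0 y) {i j : ℕ}
    {O W₁ W₂ : Set Ω} (hW₁ : MeasurableSet[C j] W₁) (hW₂ : MeasurableSet[R i] W₂)
    (h₁ : W₁ ⊆ O) (h₂ : W₂ ⊆ O) (hO : ∀ ω, ω ∉ O → y ω = 0) :
    ∀ᵐ ω ∂μ, ω ∉ O → rectInc μ R C F i j y ω =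
      (μ[(W₁ ∩ W₂).indicator y|F i j]) ω - (μ[(W₁ ∪ W₂)ᶜ.indicator y|F i j]) ω -
      (μ[fun ω => W₁ᶜ.indicator y ω - (μ[W₁ᶜ.indicator y|R i]) ω|C j]) ω -
      (μ[fun ω => W₂ᶜ.indicator y ω - (μ[W₂ᶜ.indicator y|C j]) ω|R i]) ω := by
  have hm₁ : MeasurableSet[m0] W₁ := C.le j _ hW₁
  have hm₂ : MeasurableSet[m0] W₂ := R.le i _ hW₂
  have hb₁ : BddMeas μ (C j) (W₁.indicator fun _ => (1 : ℝ)) := (BddMeas.const 1).indicator hW₁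
  have hb₂ : BddMeas μ (R i) (W₂.indicator fun _ => (1 : ℝ)) := (BddMeas.const 1).indicator hW₂
  have hy₁ := hy.indicator hm₁.compl
  have hy₂ := hy.indicator hm₂.compl
  have hp := hy.indicator (hm₁.inter hm₂)
  have hq := hy.indicator (hm₁.union hm₂).compl
  have hs₁ : y = fun ω => W₁ᶜ.indicator y ω + W₁.indicator (fun _ => (1 : ℝ)) ω * y ω := by
    ext ω; by_cases hω : ω ∈ W₁ <;> simp [hω]
  have hs₂ : y = fun ω => W₂ᶜ.indicator y ω + W₂.indicator (fun _ => (1 : ℝ)) ω * y ω := by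
    ext ω; by_cases hω : ω ∈ W₂ <;> simp [hω]
  have hs : y = fun ω => (W₁ᶜ.indicator y ω + W₂ᶜ.indicator y ω) +
      ((W₁ ∩ W₂).indicator y ω - (W₁ ∪ W₂)ᶜ.indicator y ω) := by
    ext ω; by_cases hω : ω ∈ W₁ <;> by_cases hω' : ω ∈ W₂ <;> simp [hω, hω']
  have hC : μ[y|C j] =ᵐ[μ] fun ω => (μ[W₁ᶜ.indicator y|C j]) ω +
      W₁.indicator (fun _ => (1 : ℝ)) ω * (μ[y|C j]) ω := by
    have h1 := BddMeas.condExp_add (m := C j) hy₁ ((hb₁.mono (C.le j)).mul hy)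
    rw [← hs₁] at h1
    filter_upwards [h1, hb₁.condExp_mul_left hy (C.le j)] with ω h1 h2
    exact h1.trans (by rw [h2])
  have hR : μ[y|R i] =ᵐ[μ] fun ω => (μ[W₂ᶜ.indicator y|R i]) ω +
      W₂.indicator (fun _ => (1 : ℝ)) ω * (μ[y|R i]) ω := by
    have h1 := BddMeas.condExp_add (m := R i) hy₂ ((hb₂.mono (R.le i)).mul hy)
    rw [← hs₂] at h1
    filter_upwards [h1, hb₂.condExp_mul_left hy (R.le i)] with ω h1 h2
    exact h1.trans (by rw [h2])
  have hF : μ[y|F i j] =ᵐ[μ] fun ω =>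
      ((μ[W₁ᶜ.indicator y|F i j]) ω + (μ[W₂ᶜ.indicator y|F i j]) ω) +
      ((μ[(W₁ ∩ W₂).indicator y|F i j]) ω - (μ[(W₁ ∪ W₂)ᶜ.indicator y|F i j]) ω) := by
    have h1 := BddMeas.condExp_add (m := F i j) (hy₁.add hy₂) (hp.sub hq)
    rw [← hs] at h1
    filter_upwards [h1, BddMeas.condExp_add (m := F i j) hy₁ hy₂,
      BddMeas.condExp_sub (m := F i j) hp hq] with ω h1 h2 h3
    rw [h1, h2, h3]
  filter_upwards [hC, hR, hF, BddMeas.condExp_sub (m := C j) hy₁ (hy₁.condExp' (m := R i)),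
    BddMeas.condExp_sub (m := R i) hy₂ (hy₂.condExp' (m := C j)),
    h.col_row i j _ hy₁.integrable, h.row_col i j _ hy₂.integrable]
    with ω hC hR hF h3 h4 h5 h6 hω
  have n1 : ω ∉ W₁ := fun hw => hω (h₁ hw)
  have n2 : ω ∉ W₂ := fun hw => hω (h₂ hw)
  simp only [n1, n2, Set.indicator_of_notMem, not_false_eq_true, zero_mul, add_zero] at hC hR
  rw [h3, h4, h5, h6, rectInc, hO ω hω, hC, hR, hF]
  ring

end IsCommutingGrid

/-- The set where `𝔼[1_U | F k l] > 1/2` for some `k ≤ n`, `l ≤ m`. -/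
def enlarge {Ω : Type*} {m0 : MeasurableSpace Ω} (μ : Measure Ω) (F : ℕ → ℕ → MeasurableSpace Ω)
    (U : Set Ω) (n m : ℕ) : Set Ω :=
  ⋃ k ≤ n, ⋃ l ≤ m, {ω | 1 / 2 < (μ[U.indicator fun _ => (1 : ℝ)|F k l]) ω}

theorem mem_enlarge {Ω : Type*} {m0 : MeasurableSpace Ω} {μ : Measure Ω}
    {F : ℕ → ℕ → MeasurableSpace Ω} {U : Set Ω} {n m : ℕ} {ω : Ω} :
    ω ∈ enlarge μ F U n m ↔
      ∃ k ≤ n, ∃ l ≤ m, 1 / 2 < (μ[U.indicator fun _ => (1 : ℝ)|F k l]) ω := by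
  simp [enlarge]

theorem enlarge_mono {Ω : Type*} {m0 : MeasurableSpace Ω} {μ : Measure Ω}
    {F : ℕ → ℕ → MeasurableSpace Ω} {U : Set Ω} {n m n' m' : ℕ} (hn : n ≤ n') (hm : m ≤ m') :
    enlarge μ F U n m ⊆ enlarge μ F U n' m' := by
  intro ω
  simp only [mem_enlarge]
  rintro ⟨k, hk, l, hl, h⟩
  exact ⟨k, hk.trans hn, l, hl.trans hm, h⟩

theorem measurableSet_half_lt_condExp {Ω : Type*} {m m0 : MeasurableSpace Ω} (μ : Measure Ω)
    (f : Ω → ℝ) : MeasurableSet[m] {ω | 1 / 2 < (μ[f|m]) ω} :=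
  (stronglyMeasurable_condExp (f := f)).measurable measurableSet_Ioi

namespace IsCommutingGrid

variable {Ω : Type*} {m0 : MeasurableSpace Ω} {μ : Measure Ω} {R C : Filtration ℕ m0}
  {F : ℕ → ℕ → MeasurableSpace Ω}

theorem measurableSet_enlarge (h : IsCommutingGrid μ R C F) (U : Set Ω) (n m : ℕ) :
    MeasurableSet[F n m] (enlarge μ F U n m) := by
  refine MeasurableSet.iUnion fun k => MeasurableSet.iUnion fun hk => MeasurableSet.iUnion fun l =>
    MeasurableSet.iUnion fun hl => h.mono hk hl _ (measurableSet_half_lt_condExp μ _)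

variable [IsFiniteMeasure μ]

theorem measureReal_enlarge_le (h : IsCommutingGrid μ R C F) {U : Set Ω}
    (hU : MeasurableSet[m0] U) (N : ℕ) : μ.real (enlarge μ F U N N) ≤ 64 * μ.real U := by
  have hb : BddMeas μ m0 (U.indicator fun _ => (1 : ℝ)) := (BddMeas.const 1).indicator hU
  have hE := h.le N N _ (h.measurableSet_enlarge U N N)
  obtain ⟨G, hG, hle, hi⟩ := h.doob_sq hb N
  have e1 : ∫ ω, U.indicator (fun _ => (1 : ℝ)) ω ^ 2 ∂μ = μ.real U := by
    rw [← integral_indicator_one hU]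
    refine integral_congr_ae (.of_forall fun ω => ?_)
    by_cases hω : ω ∈ U <;> simp [hω]
  have e2 : μ.real (enlarge μ F U N N) ≤ ∫ ω, 4 * G ω ^ 2 ∂μ := by
    rw [← integral_indicator_one hE]
    refine BddMeas.integral_mono ((BddMeas.const 1).indicator hE) (hG.sq.const_mul 4) ?_
    filter_upwards [hle] with ω h1
    by_cases hω : ω ∈ enlarge μ F U N N
    · obtain ⟨k, hk, l, hl, h2⟩ := mem_enlarge.1 hω
      have h3 := (le_abs_self _).trans (h1 k hk l hl)
      simp only [hω, Set.indicator_of_mem]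
      norm_num
      nlinarith
    · simp only [hω, Set.indicator_of_notMem, not_false_eq_true]
      positivity
  rw [integral_const_mul] at e2
  linarith

/-- `exists_dom_mixSum` for arrays living on a growing family of sets and outside the region where
the conditional probability of the largest of them exceeds `1/2`. -/
theorem exists_dom_mixSum_of_support (h : IsCommutingGrid μ R C F) {z : ℕ → ℕ → Ω → ℝ}
    (hz : ∀ i j, BddMeas μ (F (i + 1) (j + 1)) (z i j)) {B : ℕ → ℕ → Set Ω}
    (hB : ∀ i j, MeasurableSet[F i j] (B i j))
    (hBmono : ∀ i k j l, i ≤ k → j ≤ l → B i j ⊆ B k l)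
    (hzB : ∀ i j ω, z i j ω ≠ 0 → ω ∈ B (i + 1) (j + 1)) {N : ℕ}
    (hzQ : ∀ i j ω, z i j ω ≠ 0 →
      ω ∉ {ω | 1 / 2 < (μ[(B N N).indicator fun _ => (1 : ℝ)|F (i + 1) j]) ω}) :
    ∃ G : Ω → ℝ, BddMeas μ m0 G ∧
      (∀ᵐ ω ∂μ, ∀ n ≤ N, ∀ m ≤ N, |mixSum μ R C z n m ω| ≤ G ω) ∧
      ∫ ω, G ω ∂μ ≤ 22 * ∫ ω, sqFun z N ω ∂μ := by
  refine h.exists_dom_mixSum hz (H := fun j => B N j) (fun j => h.le_col N j _ (hB N j))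
    (fun i j l ω hi hjl _ h0 => hBmono _ _ _ _ hi hjl (hzB i j ω h0)) fun i j _ hj => ?_
  have hb : ∀ l, BddMeas μ m0 ((B N l).indicator fun _ => (1 : ℝ)) := fun l =>
    (BddMeas.const 1).indicator (h.le _ _ _ (hB N l))
  filter_upwards [condExp_mono (m := F (i + 1) j) (hb j).integrable (hb N).integrable
    (.of_forall fun ω => Set.indicator_le_indicator_of_subset
      (hBmono N N j N le_rfl hj.le) (fun _ => zero_le_one) ω)] with ω h1 h0
  exact h1.trans (not_lt.1 (hzQ i j ω h0))

/-- The weak-type building block: rectangular sums of an array living on a growing family of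
sets `B` have an integrable maximal function controlled by the measure of the largest of these
sets and the `L²` norm of the array. -/
theorem exists_dom_rectSum_of_support (h : IsCommutingGrid μ R C F) {y : ℕ → ℕ → Ω → ℝ}
    (hy : ∀ i j, BddMeas μ (F (i + 1) (j + 1)) (y i j)) {B : ℕ → ℕ → Set Ω}
    (hB : ∀ i j, MeasurableSet[F i j] (B i j))
    (hBmono : ∀ i k j l, i ≤ k → j ≤ l → B i j ⊆ B k l)
    (hyB : ∀ i j ω, y i j ω ≠ 0 → ω ∈ B (i + 1) (j + 1)) (N : ℕ) {lam : ℝ} (hlam : 0 < lam) :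
    ∃ G : Ω → ℝ, BddMeas μ m0 G ∧
      (∀ᵐ ω ∂μ, ∀ n ≤ N, ∀ m ≤ N, |rectSum μ R C F y n m ω| ≤ G ω) ∧
      ∫ ω, G ω ∂μ ≤ 400 * (lam * μ.real (B N N) + lam⁻¹ *
        ∑ i ∈ Finset.range N, ∑ j ∈ Finset.range N, ∫ ω, y i j ω ^ 2 ∂μ) := by
  let Q : ℕ → ℕ → Set Ω := fun i j =>
    {ω | 1 / 2 < (μ[(B N N).indicator fun _ => (1 : ℝ)|F i j]) ω}
  have hQ : ∀ i j, MeasurableSet[F i j] (Q i j) := fun i j => measurableSet_half_lt_condExp μ _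
  let O : Set Ω := B N N ∪ enlarge μ F (B N N) N N
  have hBN : MeasurableSet[m0] (B N N) := h.le _ _ _ (hB N N)
  have hO : MeasurableSet[m0] O := hBN.union (h.le _ _ _ (h.measurableSet_enlarge _ N N))
  have hOμ : μ.real O ≤ 65 * μ.real (B N N) := by
    have h1 := measureReal_union_le (μ := μ) (B N N) (enlarge μ F (B N N) N N)
    have h2 := h.measureReal_enlarge_le hBN N
    linarith
  have hQO : ∀ i j, i ≤ N → j ≤ N → Q i j ⊆ O := fun i j hi hj ω hω =>
    Or.inr (mem_enlarge.2 ⟨i, hi, j, hj, hω⟩)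
  have hy0 := fun i j => (hy i j).mono (h.le _ _)
  have hyO : ∀ i j, i < N → j < N → ∀ ω, ω ∉ O → y i j ω = 0 := by
    intro i j hi hj ω hω
    by_contra h0
    exact hω (Or.inl (hBmono _ _ _ _ hi hj (hyB i j ω h0)))
  have hW₁ : ∀ i j, MeasurableSet[F (i + 1) (j + 1)] (Q (i + 1) j) := fun i j =>
    h.mono le_rfl j.le_succ _ (hQ _ _)
  have hW₂ : ∀ i j, MeasurableSet[F (i + 1) (j + 1)] (Q i (j + 1)) := fun i j =>
    h.mono i.le_succ le_rfl _ (hQ _ _)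
  let y₁ : ℕ → ℕ → Ω → ℝ := fun i j => (Q (i + 1) j)ᶜ.indicator (y i j)
  let y₂ : ℕ → ℕ → Ω → ℝ := fun i j => (Q i (j + 1))ᶜ.indicator (y i j)
  let p : ℕ → ℕ → Ω → ℝ := fun i j => (Q (i + 1) j ∩ Q i (j + 1)).indicator (y i j)
  let q : ℕ → ℕ → Ω → ℝ := fun i j => (Q (i + 1) j ∪ Q i (j + 1))ᶜ.indicator (y i j)
  let p' : ℕ → ℕ → Ω → ℝ := fun i j ω => |p i j ω|
  let q' : ℕ → ℕ → Ω → ℝ := fun i j ω => |q i j ω|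
  have hy₁ : ∀ i j, BddMeas μ (F (i + 1) (j + 1)) (y₁ i j) := fun i j =>
    (hy i j).indicator (hW₁ i j).compl
  have hy₂ : ∀ i j, BddMeas μ (F (i + 1) (j + 1)) (y₂ i j) := fun i j =>
    (hy i j).indicator (hW₂ i j).compl
  have hp : ∀ i j, BddMeas μ (F (i + 1) (j + 1)) (p i j) := fun i j =>
    (hy i j).indicator ((hW₁ i j).inter (hW₂ i j))
  have hq : ∀ i j, BddMeas μ (F (i + 1) (j + 1)) (q i j) := fun i j =>
    (hy i j).indicator ((hW₁ i j).union (hW₂ i j)).compl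
  have hp' : ∀ i j, BddMeas μ (F (i + 1) (j + 1)) (p' i j) := fun i j => (hp i j).abs
  have hq' : ∀ i j, BddMeas μ (F (i + 1) (j + 1)) (q' i j) := fun i j => (hq i j).abs
  have ind_le : ∀ (A : Set Ω) (f : Ω → ℝ) (ω : Ω), |A.indicator f ω| ≤ |f ω| := fun A f ω =>
    norm_indicator_le_norm_self f ω
  have ne_of : ∀ {A : Set Ω} {f : Ω → ℝ} {ω : Ω}, A.indicator f ω ≠ 0 → ω ∈ A ∧ f ω ≠ 0 :=
    fun {A f ω} h0 => ⟨Set.mem_of_indicator_ne_zero h0, fun h1 =>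
      h0 (Set.indicator_apply_eq_zero.2 fun _ => h1)⟩
  have sq_le : ∀ z : ℕ → ℕ → Ω → ℝ, (∀ i j, BddMeas μ (F (i + 1) (j + 1)) (z i j)) →
      (∀ i j ω, |z i j ω| ≤ |y i j ω|) → ∫ ω, sqFun z N ω ∂μ ≤ ∫ ω, sqFun y N ω ∂μ :=
    fun z hz hzy => BddMeas.integral_mono (bddMeas_sqFun (fun i j => (hz i j).mono (h.le _ _)) N)
      (bddMeas_sqFun hy0 N) (.of_forall fun ω => sqFun_mono fun i j => hzy i j ω)
  obtain ⟨G₂, hG₂, hle₂, hi₂⟩ := h.exists_dom_rectSum hy N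
  obtain ⟨G₃, hG₃, hle₃, hi₃⟩ := h.exists_dom_mixSum_of_support hy₁ hB hBmono
    (fun i j ω h0 => hyB i j ω (ne_of h0).2) (N := N) (fun i j ω h0 => (ne_of h0).1)
  obtain ⟨G₄, hG₄, hle₄, hi₄⟩ := h.symm.exists_dom_mixSum_of_support
    (z := fun j i => y₂ i j) (fun j i => hy₂ i j) (B := fun j i => B i j) (fun j i => hB i j)
    (fun _ _ _ _ h1 h2 => hBmono _ _ _ _ h2 h1)
    (fun j i ω h0 => hyB i j ω (ne_of h0).2) (N := N) (fun j i ω h0 => (ne_of h0).1)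
  obtain ⟨G₅, hG₅, hle₅, hi₅⟩ := h.exists_dom_mixSum_of_support hq' hB hBmono
    (fun i j ω h0 => hyB i j ω (ne_of (abs_ne_zero.1 h0)).2) (N := N)
    (fun i j ω h0 hm => (ne_of (abs_ne_zero.1 h0)).1 (Or.inl hm))
  obtain ⟨G₆, hG₆, hle₆, hi₆⟩ := h.symm.exists_dom_mixSum_of_support
    (z := fun j i => q' i j) (fun j i => hq' i j) (B := fun j i => B i j) (fun j i => hB i j)
    (fun _ _ _ _ h1 h2 => hBmono _ _ _ _ h2 h1)
    (fun j i ω h0 => hyB i j ω (ne_of (abs_ne_zero.1 h0)).2) (N := N)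
    (fun j i ω h0 hm => (ne_of (abs_ne_zero.1 h0)).1 (Or.inr hm))
  rw [sqFun_symm] at hi₄ hi₆
  have hi₇ := h.integral_abs_rectSum_le hp' N
  have hi₈ := h.integral_abs_rectSum_le hq' N
  have hRp := (h.bddMeas_rectSum hp' N N).abs
  have hRq := (h.bddMeas_rectSum hq' N N).abs
  have off : ∀ (x : Ω → ℝ), BddMeas μ m0 x → ∀ i j, i < N → j < N →
      (∀ ω, ω ∉ O → x ω = 0) → ∀ᵐ ω ∂μ, ω ∉ O → rectInc μ R C F i j x ω =
      (μ[(Q (i + 1) j ∩ Q i (j + 1)).indicator x|F i j]) ω -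
      (μ[(Q (i + 1) j ∪ Q i (j + 1))ᶜ.indicator x|F i j]) ω -
      (μ[fun ω => (Q (i + 1) j)ᶜ.indicator x ω - (μ[(Q (i + 1) j)ᶜ.indicator x|R i]) ω|C j]) ω -
      (μ[fun ω => (Q i (j + 1))ᶜ.indicator x ω - (μ[(Q i (j + 1))ᶜ.indicator x|C j]) ω|R i]) ω :=
    fun x hx i j hi hj hxO => h.rectInc_eq_off hx (h.le_col _ _ _ (hQ (i + 1) j))
      (h.le_row _ _ _ (hQ i (j + 1))) (hQO _ _ hi hj.le) (hQO _ _ hi.le hj) hxO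
  have hoff : ∀ i j, ∀ᵐ ω ∂μ, i < N → j < N → ω ∉ O → rectInc μ R C F i j (y i j) ω =
      (μ[p i j|F i j]) ω - (μ[q i j|F i j]) ω -
      (μ[fun ω => y₁ i j ω - (μ[y₁ i j|R i]) ω|C j]) ω -
      (μ[fun ω => y₂ i j ω - (μ[y₂ i j|C j]) ω|R i]) ω := by
    intro i j
    by_cases hij : i < N ∧ j < N
    · filter_upwards [off (y i j) (hy0 i j) i j hij.1 hij.2 (hyO i j hij.1 hij.2)]
        with ω hω _ _ using hω
    · exact .of_forall fun ω h1 h2 => absurd ⟨h1, h2⟩ hij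
  have hoffp : ∀ i j, ∀ᵐ ω ∂μ, i < N → j < N → ω ∉ O →
      (μ[p' i j|F i j]) ω = rectInc μ R C F i j (p' i j) ω := by
    intro i j
    by_cases hij : i < N ∧ j < N
    · have hx : ∀ ω, ω ∉ O → p' i j ω = 0 := fun ω hω => by
        simp [p', p, hyO i j hij.1 hij.2 ω hω]
      have e1 : (Q (i + 1) j ∩ Q i (j + 1)).indicator (p' i j) = p' i j := by
        ext ω; by_cases hω : ω ∈ Q (i + 1) j ∩ Q i (j + 1) <;> simp [p', p, hω]
      have e2 : (Q (i + 1) j ∪ Q i (j + 1))ᶜ.indicator (p' i j) = 0 := by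
        ext ω
        by_cases h1 : ω ∈ Q (i + 1) j <;> by_cases h2 : ω ∈ Q i (j + 1) <;> simp [p', p, h1, h2]
      have e3 : (Q (i + 1) j)ᶜ.indicator (p' i j) = 0 := by
        ext ω; by_cases h1 : ω ∈ Q (i + 1) j <;> simp [p', p, h1]
      have e4 : (Q i (j + 1))ᶜ.indicator (p' i j) = 0 := by
        ext ω; by_cases h1 : ω ∈ Q i (j + 1) <;> simp [p', p, h1]
      filter_upwards [off (p' i j) ((hp' i j).mono (h.le _ _)) i j hij.1 hij.2 hx] with ω hω _ _ hO
      rw [hω hO, e1, e2, e3, e4]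
      simp [condExp_zero, ← Pi.zero_def]
    · exact .of_forall fun ω h1 h2 => absurd ⟨h1, h2⟩ hij
  have hoffq : ∀ i j, ∀ᵐ ω ∂μ, i < N → j < N → ω ∉ O →
      (μ[q' i j|F i j]) ω = -rectInc μ R C F i j (q' i j) ω -
      (μ[fun ω => q' i j ω - (μ[q' i j|R i]) ω|C j]) ω -
      (μ[fun ω => q' i j ω - (μ[q' i j|C j]) ω|R i]) ω := by
    intro i j
    by_cases hij : i < N ∧ j < N
    · have hx : ∀ ω, ω ∉ O → q' i j ω = 0 := fun ω hω => by
        simp [q', q, hyO i j hij.1 hij.2 ω hω]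
      have e1 : (Q (i + 1) j ∩ Q i (j + 1)).indicator (q' i j) = 0 := by
        ext ω
        by_cases h1 : ω ∈ Q (i + 1) j <;> by_cases h2 : ω ∈ Q i (j + 1) <;> simp [q', q, h1, h2]
      have e2 : (Q (i + 1) j ∪ Q i (j + 1))ᶜ.indicator (q' i j) = q' i j := by
        ext ω
        by_cases h1 : ω ∈ Q (i + 1) j <;> by_cases h2 : ω ∈ Q i (j + 1) <;> simp [q', q, h1, h2]
      have e3 : (Q (i + 1) j)ᶜ.indicator (q' i j) = q' i j := by
        ext ω; by_cases h1 : ω ∈ Q (i + 1) j <;> simp [q', q, h1]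
      have e4 : (Q i (j + 1))ᶜ.indicator (q' i j) = q' i j := by
        ext ω; by_cases h1 : ω ∈ Q i (j + 1) <;> simp [q', q, h1]
      filter_upwards [off (q' i j) ((hq' i j).mono (h.le _ _)) i j hij.1 hij.2 hx] with ω hω _ _ hO
      have h1 := hω hO
      rw [e1, e2, e3, e4] at h1
      simp only [condExp_zero, Pi.zero_apply] at h1
      rw [h1]
      ring
    · exact .of_forall fun ω h1 h2 => absurd ⟨h1, h2⟩ hij
  have hpa : ∀ i j, ∀ᵐ ω ∂μ, |(μ[p i j|F i j]) ω| ≤ (μ[p' i j|F i j]) ω := fun i j =>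
    norm_condExp_le (m := F i j) (μ := μ) (p i j)
  have hqa : ∀ i j, ∀ᵐ ω ∂μ, |(μ[q i j|F i j]) ω| ≤ (μ[q' i j|F i j]) ω := fun i j =>
    norm_condExp_le (m := F i j) (μ := μ) (q i j)
  let G₁ : Ω → ℝ := O.indicator G₂
  let T : Ω → ℝ := fun ω => |rectSum μ R C F p' N N ω| + |rectSum μ R C F q' N N ω| +
    (G₅ ω + G₆ ω) + (G₃ ω + G₄ ω)
  have hG₁ : BddMeas μ m0 G₁ := hG₂.indicator hO
  have hT : BddMeas μ m0 T := ((hRp.add hRq).add (hG₅.add hG₆)).add (hG₃.add hG₄)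
  refine ⟨fun ω => G₁ ω + T ω, hG₁.add hT, ?_, ?_⟩
  · filter_upwards [hle₂, hle₃, hle₄, hle₅, hle₆, ae_all_iff.2 fun i => ae_all_iff.2 (hoff i),
      ae_all_iff.2 fun i => ae_all_iff.2 (hoffp i), ae_all_iff.2 fun i => ae_all_iff.2 (hoffq i),
      ae_all_iff.2 fun i => ae_all_iff.2 (hpa i), ae_all_iff.2 fun i => ae_all_iff.2 (hqa i)]
      with ω h2 h3 h4 h5 h6 ho hop hoq hpa hqa n hn m hm
    have g3 := (abs_nonneg _).trans (h3 0 (Nat.zero_le _) 0 (Nat.zero_le _))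
    have g4 := (abs_nonneg _).trans (h4 0 (Nat.zero_le _) 0 (Nat.zero_le _))
    have g5 := (abs_nonneg _).trans (h5 0 (Nat.zero_le _) 0 (Nat.zero_le _))
    have g6 := (abs_nonneg _).trans (h6 0 (Nat.zero_le _) 0 (Nat.zero_le _))
    have gp := abs_nonneg (rectSum μ R C F p' N N ω)
    have gq := abs_nonneg (rectSum μ R C F q' N N ω)
    by_cases hω : ω ∈ O
    · simp only [G₁, T, hω, Set.indicator_of_mem]
      linarith [h2 n hn m hm]
    simp only [G₁, T, hω, Set.indicator_of_notMem, not_false_eq_true, zero_add]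
    have sub_sum : ∀ g : ℕ → ℕ → ℝ, (∀ i j, 0 ≤ g i j) →
        ∑ i ∈ Finset.range n, ∑ j ∈ Finset.range m, g i j ≤
          ∑ i ∈ Finset.range N, ∑ j ∈ Finset.range N, g i j := fun g hg =>
      (Finset.sum_le_sum fun i _ => Finset.sum_le_sum_of_subset_of_nonneg (Finset.range_mono hm)
        fun j _ _ => hg i j).trans (Finset.sum_le_sum_of_subset_of_nonneg (Finset.range_mono hn)
          fun i _ _ => Finset.sum_nonneg fun j _ => hg i j)
    have sum_congr : ∀ {k l : ℕ} {f g : ℕ → ℕ → ℝ}, k ≤ N → l ≤ N →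
        (∀ i j, i < N → j < N → f i j = g i j) →
        ∑ i ∈ Finset.range k, ∑ j ∈ Finset.range l, f i j =
          ∑ i ∈ Finset.range k, ∑ j ∈ Finset.range l, g i j := fun hk hl hfg =>
      Finset.sum_congr rfl fun i hi => Finset.sum_congr rfl fun j hj =>
        hfg i j ((Finset.mem_range.1 hi).trans_le hk) ((Finset.mem_range.1 hj).trans_le hl)
    have hP : ∑ i ∈ Finset.range N, ∑ j ∈ Finset.range N, (μ[p' i j|F i j]) ω =
        rectSum μ R C F p' N N ω := sum_congr le_rfl le_rfl fun i j hi hj => hop i j hi hj hω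
    have hmix : ∀ (z : ℕ → ℕ → Ω → ℝ) (n m : ℕ), ∑ i ∈ Finset.range n, ∑ j ∈ Finset.range m,
        (μ[fun ω => z i j ω - (μ[z i j|C j]) ω|R i]) ω =
          mixSum μ C R (fun j i => z i j) m n ω := fun z n m => by
      rw [mixSum, Finset.sum_comm]
    have hQs : ∑ i ∈ Finset.range N, ∑ j ∈ Finset.range N, (μ[q' i j|F i j]) ω =
        -rectSum μ R C F q' N N ω - mixSum μ R C q' N N ω -
          mixSum μ C R (fun j i => q' i j) N N ω := by
      rw [sum_congr le_rfl le_rfl fun i j hi hj => hoq i j hi hj hω]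
      simp only [Finset.sum_sub_distrib, Finset.sum_neg_distrib, hmix]
      rfl
    have hS : rectSum μ R C F y n m ω =
        ∑ i ∈ Finset.range n, ∑ j ∈ Finset.range m, (μ[p i j|F i j]) ω -
        ∑ i ∈ Finset.range n, ∑ j ∈ Finset.range m, (μ[q i j|F i j]) ω -
        mixSum μ R C y₁ n m ω - mixSum μ C R (fun j i => y₂ i j) m n ω := by
      rw [rectSum, sum_congr hn hm fun i j hi hj => ho i j hi hj hω]
      simp only [Finset.sum_sub_distrib, hmix]
      rfl
    have abs_sum : ∀ f g : ℕ → ℕ → ℝ, (∀ i j, |f i j| ≤ g i j) →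
        |∑ i ∈ Finset.range n, ∑ j ∈ Finset.range m, f i j| ≤
          ∑ i ∈ Finset.range N, ∑ j ∈ Finset.range N, g i j := fun f g hfg =>
      ((Finset.abs_sum_le_sum_abs _ _).trans (Finset.sum_le_sum fun i _ =>
        (Finset.abs_sum_le_sum_abs _ _).trans (Finset.sum_le_sum fun j _ => hfg i j))).trans
        (sub_sum g fun i j => (abs_nonneg _).trans (hfg i j))
    have k1 := abs_sum _ _ hpa
    have k2 := abs_sum _ _ hqa
    rw [hP] at k1
    rw [hQs] at k2
    have k3 := h3 n hn m hm
    have k4 := h4 m hm n hn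
    have k5 := h5 N le_rfl N le_rfl
    have k6 := h6 N le_rfl N le_rfl
    rw [hS]
    have kp := le_abs_self (rectSum μ R C F p' N N ω)
    have kq := neg_abs_le (rectSum μ R C F q' N N ω)
    rw [abs_le] at k1 k2 k3 k4 k5 k6 ⊢
    constructor <;> linarith
  · have hE : ∫ ω, sqFun y N ω ^ 2 ∂μ =
        ∑ i ∈ Finset.range N, ∑ j ∈ Finset.range N, ∫ ω, y i j ω ^ 2 ∂μ := by
      have e : ∀ ω, sqFun y N ω ^ 2 =
          ∑ i ∈ Finset.range N, ∑ j ∈ Finset.range N, y i j ω ^ 2 := fun ω =>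
        Real.sq_sqrt (Finset.sum_nonneg fun i _ => Finset.sum_nonneg fun j _ => sq_nonneg _)
      simp only [e]
      rw [BddMeas.integral_sum _ fun i _ => BddMeas.sum _ fun j _ => (hy0 i j).sq]
      exact Finset.sum_congr rfl fun i _ => BddMeas.integral_sum _ fun j _ => (hy0 i j).sq
    set E := ∑ i ∈ Finset.range N, ∑ j ∈ Finset.range N, ∫ ω, y i j ω ^ 2 ∂μ
    have amgm : ∀ {A : Set Ω} {g : Ω → ℝ}, MeasurableSet[m0] A → BddMeas μ m0 g →
        ∫ ω, A.indicator g ω ∂μ ≤ lam * μ.real A + lam⁻¹ * ∫ ω, g ω ^ 2 ∂μ := by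
      intro A g hA hg
      have h1 : BddMeas μ m0 (A.indicator (1 : Ω → ℝ)) := (BddMeas.const 1).indicator hA
      rw [← integral_indicator_one hA, ← integral_const_mul, ← integral_const_mul,
        ← BddMeas.integral_add (h1.const_mul lam) (hg.sq.const_mul lam⁻¹)]
      refine BddMeas.integral_mono (hg.indicator hA)
        ((h1.const_mul lam).add (hg.sq.const_mul lam⁻¹)) (.of_forall fun ω => ?_)
      have hl := inv_pos.2 hlam
      by_cases hω : ω ∈ A
      · simp only [hω, Set.indicator_of_mem, Pi.one_apply, mul_one]
        have h2 : lam⁻¹ * (g ω - lam) ^ 2 = lam⁻¹ * g ω ^ 2 - 2 * g ω + lam := by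
          field_simp
          ring
        have h3 : 0 ≤ lam⁻¹ * (g ω - lam) ^ 2 := by positivity
        have h4 : 0 ≤ lam⁻¹ * g ω ^ 2 := by positivity
        linarith
      · simp only [hω, Set.indicator_of_notMem, not_false_eq_true]
        nlinarith [mul_nonneg hl.le (sq_nonneg (g ω))]
    have hMy : ∫ ω, sqFun y N ω ∂μ ≤ lam * μ.real (B N N) + lam⁻¹ * E := by
      have h1 := amgm hBN (bddMeas_sqFun hy0 N)
      rw [hE] at h1
      refine le_trans (le_of_eq (integral_congr_ae (.of_forall fun ω => ?_))) h1
      by_cases hω : ω ∈ B N N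
      · simp [hω]
      · have h0 : ∀ i ∈ Finset.range N, ∀ j ∈ Finset.range N, y i j ω ^ 2 = 0 := by
          intro i hi j hj
          by_contra h0
          exact hω (hBmono _ _ _ _ (Finset.mem_range.1 hi) (Finset.mem_range.1 hj)
            (hyB i j ω fun h1 => h0 (by simp [h1])))
        simp only [hω, sqFun, not_false_eq_true, Set.indicator_of_notMem]
        rw [Finset.sum_eq_zero fun i hi => Finset.sum_eq_zero (h0 i hi), Real.sqrt_zero]
    have hM1 : ∫ ω, G₁ ω ∂μ ≤ lam * μ.real O + lam⁻¹ * (16 * E) :=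
      (amgm hO hG₂).trans (by gcongr)
    have m1 := sq_le y₁ hy₁ fun i j ω => ind_le _ _ _
    have m2 := sq_le y₂ hy₂ fun i j ω => ind_le _ _ _
    have m3 := sq_le p' hp' fun i j ω => (abs_abs _).trans_le (ind_le _ _ _)
    have m4 := sq_le q' hq' fun i j ω => (abs_abs _).trans_le (ind_le _ _ _)
    have hTi : ∫ ω, T ω ∂μ = ∫ ω, |rectSum μ R C F p' N N ω| ∂μ +
        ∫ ω, |rectSum μ R C F q' N N ω| ∂μ + (∫ ω, G₅ ω ∂μ + ∫ ω, G₆ ω ∂μ) +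
        (∫ ω, G₃ ω ∂μ + ∫ ω, G₄ ω ∂μ) := by
      rw [BddMeas.integral_add ((hRp.add hRq).add (hG₅.add hG₆)) (hG₃.add hG₄),
        BddMeas.integral_add (hRp.add hRq) (hG₅.add hG₆), BddMeas.integral_add hRp hRq,
        BddMeas.integral_add hG₅ hG₆, BddMeas.integral_add hG₃ hG₄]
    rw [BddMeas.integral_add hG₁ hT, hTi]
    have hOl : lam * μ.real O ≤ lam * (65 * μ.real (B N N)) := by gcongr
    have hE0 : 0 ≤ lam⁻¹ * E := mul_nonneg (inv_pos.2 hlam).le (Finset.sum_nonneg fun i _ =>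
      Finset.sum_nonneg fun j _ => integral_nonneg fun ω => sq_nonneg _)
    have hB0 : 0 ≤ lam * μ.real (B N N) := mul_nonneg hlam.le measureReal_nonneg
    linarith

end IsCommutingGrid

theorem sum_dyadic_levels_le {s ε : ℝ} (hs : 0 ≤ s) (hε : 0 ≤ ε) (K : ℕ) :
    ∑ k ∈ Finset.range K, (if ε * 2 ^ k < s then ε * 2 ^ k else 0) ≤ 2 * s := by
  induction K with
  | zero => simpa using hs
  | succ K ih =>
    rw [Finset.sum_range_succ]
    split_ifs with hK
    · have h1 : ∀ n : ℕ, ∑ k ∈ Finset.range n, (if ε * 2 ^ k < s then ε * 2 ^ k else 0) ≤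
          ε * 2 ^ n := by
        intro n
        induction n with
        | zero => simpa using hε
        | succ n ihn =>
          rw [Finset.sum_range_succ]
          have : (if ε * 2 ^ n < s then ε * 2 ^ n else 0) ≤ ε * 2 ^ n := by
            split_ifs
            · exact le_rfl
            · positivity
          rw [pow_succ]
          linarith
      linarith [h1 K]
    · linarith

/-- The decreasing sets obtained by intersecting the enlargements of `U 0, …, U (k - 1)`. -/
def layer {Ω : Type*} {m0 : MeasurableSpace Ω} (μ : Measure Ω) (F : ℕ → ℕ → MeasurableSpace Ω)
    (U : ℕ → Set Ω) : ℕ → ℕ → ℕ → Set Ω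
  | 0, _, _ => Set.univ
  | k + 1, i, j => layer μ F U k i j ∩ enlarge μ F (U k) i j

theorem layer_mono {Ω : Type*} {m0 : MeasurableSpace Ω} {μ : Measure Ω}
    {F : ℕ → ℕ → MeasurableSpace Ω} {U : ℕ → Set Ω} (k : ℕ) {n m n' m' : ℕ} (hn : n ≤ n')
    (hm : m ≤ m') : layer μ F U k n m ⊆ layer μ F U k n' m' := by
  induction k with
  | zero => exact subset_rfl
  | succ k ih => exact Set.inter_subset_inter ih (enlarge_mono hn hm)

theorem sum_indicator_layer {Ω : Type*} {m0 : MeasurableSpace Ω} {μ : Measure Ω}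
    {F : ℕ → ℕ → MeasurableSpace Ω} {U : ℕ → Set Ω} (n m : ℕ) (f : Ω → ℝ) (K : ℕ) (ω : Ω) :
    ∑ k ∈ Finset.range K, (layer μ F U k n m \ layer μ F U (k + 1) n m).indicator f ω =
      f ω - (layer μ F U K n m).indicator f ω := by
  induction K with
  | zero => simp [layer]
  | succ K ih =>
    rw [Finset.sum_range_succ, ih]
    have hsub : layer μ F U (K + 1) n m ⊆ layer μ F U K n m := Set.inter_subset_left
    by_cases h1 : ω ∈ layer μ F U (K + 1) n m
    · simp [h1, hsub h1]
    · by_cases h2 : ω ∈ layer μ F U K n m <;> simp [h1, h2]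

namespace IsCommutingGrid

variable {Ω : Type*} {m0 : MeasurableSpace Ω} {μ : Measure Ω} {R C : Filtration ℕ m0}
  {F : ℕ → ℕ → MeasurableSpace Ω}

theorem rectInc_congr {y z : Ω → ℝ} (hyz : y =ᵐ[μ] z) (i j : ℕ) :
    rectInc μ R C F i j y =ᵐ[μ] rectInc μ R C F i j z := by
  filter_upwards [hyz, condExp_congr_ae (m := R i) hyz, condExp_congr_ae (m := C j) hyz,
    condExp_congr_ae (m := F i j) hyz] with ω h1 h2 h3 h4
  simp only [rectInc, h1, h2, h3, h4]

theorem measurableSet_layer (h : IsCommutingGrid μ R C F) (U : ℕ → Set Ω) (k n m : ℕ) :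
    MeasurableSet[F n m] (layer μ F U k n m) := by
  induction k with
  | zero => exact MeasurableSet.univ
  | succ k ih => exact ih.inter (h.measurableSet_enlarge _ n m)

variable [IsFiniteMeasure μ]

theorem rectInc_sum {y : ℕ → Ω → ℝ} (hy : ∀ k, BddMeas μ m0 (y k)) (i j K : ℕ) :
    rectInc μ R C F i j (fun ω => ∑ k ∈ Finset.range K, y k ω) =ᵐ[μ]
      fun ω => ∑ k ∈ Finset.range K, rectInc μ R C F i j (y k) ω := by
  filter_upwards [BddMeas.condExp_sum (m := R i) (Finset.range K) fun k _ => hy k,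
    BddMeas.condExp_sum (m := C j) (Finset.range K) fun k _ => hy k,
    BddMeas.condExp_sum (m := F i j) (Finset.range K) fun k _ => hy k] with ω h1 h2 h3
  simp only [rectInc, h1, h2, h3, Finset.sum_sub_distrib]

theorem rectInc_eq_self (h : IsCommutingGrid μ R C F) {y : Ω → ℝ} (hy : BddMeas μ m0 y) {i j : ℕ}
    (hR : μ[y|R i] =ᵐ[μ] fun _ => 0) (hC : μ[y|C j] =ᵐ[μ] fun _ => 0) :
    rectInc μ R C F i j y =ᵐ[μ] y := by
  have h1 : μ[y|F i j] =ᵐ[μ] fun _ => 0 :=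
    (h.row_col i j y hy.integrable).symm.trans
      ((condExp_congr_ae hC).trans (.of_eq (condExp_const (R.le i) 0)))
  filter_upwards [hR, hC, h1] with ω h1 h2 h3
  simp [rectInc, h1, h2, h3]

/-- The maximal inequality for finite arrays of bounded rectangular martingale differences. -/
theorem exists_dom_sum (h : IsCommutingGrid μ R C F) {d : ℕ → ℕ → Ω → ℝ}
    (hd : ∀ i j, BddMeas μ (F (i + 1) (j + 1)) (d i j))
    (hdR : ∀ i j, μ[d i j|R i] =ᵐ[μ] fun _ => 0) (hdC : ∀ i j, μ[d i j|C j] =ᵐ[μ] fun _ => 0)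
    (N : ℕ) {ε : ℝ} (hε : 0 < ε) :
    ∃ G : Ω → ℝ, BddMeas μ m0 G ∧
      (∀ᵐ ω ∂μ, ∀ n ≤ N, ∀ m ≤ N,
        |∑ i ∈ Finset.range n, ∑ j ∈ Finset.range m, d i j ω| ≤ G ω) ∧
      ∫ ω, G ω ∂μ ≤ 307200 * ∫ ω, sqFun d N ω ∂μ + 1200 * (ε * μ.real Set.univ) := by
  have hd0 := fun i j => (hd i j).mono (h.le _ _)
  have hS := bddMeas_sqFun hd0 N
  obtain ⟨S, hSm, hSe⟩ := hS.1
  have hSb : BddMeas μ m0 S := hS.congr hSe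
  obtain ⟨M, hM⟩ := hSb.2
  obtain ⟨K, hK⟩ := pow_unbounded_of_one_lt (M / ε) one_lt_two
  let lam : ℕ → ℝ := fun k => ε * 2 ^ k
  have hlam : ∀ k, 0 < lam k := fun k => by positivity
  let U : ℕ → Set Ω := fun k => {ω | lam k < S ω}
  have hU : ∀ k, MeasurableSet[m0] (U k) := fun k => hSm.measurable measurableSet_Ioi
  let T : ℕ → ℕ → ℕ → Set Ω := layer μ F U
  have hT : ∀ k i j, MeasurableSet[F i j] (T k i j) := h.measurableSet_layer U
  have hT0 : ∀ k, MeasurableSet[m0] (T k N N) := fun k => h.le _ _ _ (hT k N N)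
  have hTμ : ∀ k, μ.real (T (k + 1) N N) ≤ 64 * μ.real (U k) := fun k =>
    (measureReal_mono Set.inter_subset_right).trans (h.measureReal_enlarge_le (hU k) N)
  have hUK : μ.real (U K) = 0 := by
    have h1 : ∀ᵐ ω ∂μ, ω ∉ U K := by
      filter_upwards [hM] with ω hω hlt
      have h2 : M < lam K := by
        have := (div_lt_iff₀ hε).1 hK
        simp only [lam]
        linarith
      have h3 : lam K < S ω := hlt
      exact absurd ((le_abs_self _).trans hω) (not_le.2 (h2.trans h3))
    rw [measureReal_eq_zero_iff]
    exact measure_eq_zero_iff_ae_notMem.2 h1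
  have hTK : ∀ᵐ ω ∂μ, ω ∉ T (K + 1) N N := by
    have h1 : μ.real (T (K + 1) N N) = 0 :=
      le_antisymm ((hTμ K).trans (by rw [hUK, mul_zero])) measureReal_nonneg
    rw [measureReal_eq_zero_iff] at h1
    exact measure_eq_zero_iff_ae_notMem.1 h1
  let y : ℕ → ℕ → ℕ → Ω → ℝ := fun k i j =>
    (T k (i + 1) (j + 1) \ T (k + 1) (i + 1) (j + 1)).indicator (d i j)
  have hy : ∀ k i j, BddMeas μ (F (i + 1) (j + 1)) (y k i j) := fun k i j =>
    (hd i j).indicator ((hT k _ _).diff (hT (k + 1) _ _))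
  have hy0 := fun k i j => (hy k i j).mono (h.le _ _)
  have hmem : ∀ k i j ω, y k i j ω ≠ 0 → ω ∈ T k (i + 1) (j + 1) \ T (k + 1) (i + 1) (j + 1) :=
    fun k i j ω h0 => Set.mem_of_indicator_ne_zero h0
  have hsq : ∀ k, ∑ i ∈ Finset.range N, ∑ j ∈ Finset.range N, ∫ ω, y k i j ω ^ 2 ∂μ ≤
      2 * (lam k ^ 2 * μ.real (T k N N)) := by
    intro k
    have hI : ∀ i j, BddMeas μ m0 ((U k)ᶜ.indicator fun ω => y k i j ω ^ 2) := fun i j =>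
      (hy0 k i j).sq.indicator (hU k).compl
    have h1 : ∀ i j, ∫ ω, y k i j ω ^ 2 ∂μ ≤
        2 * ∫ ω, (U k)ᶜ.indicator (fun ω => y k i j ω ^ 2) ω ∂μ := by
      intro i j
      refine BddMeas.integral_le_two_mul_compl (hy k i j).sq (h.le _ _) (fun ω => sq_nonneg _)
        (hU k) (.of_forall fun ω h0 => ?_)
      obtain ⟨hm1, hm2⟩ := hmem k i j ω fun h1 => h0 (by rw [h1]; ring)
      by_contra! hlt
      exact hm2 ⟨hm1, mem_enlarge.2 ⟨_, le_rfl, _, le_rfl, hlt⟩⟩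
    have h1T : BddMeas μ m0 ((T k N N).indicator (1 : Ω → ℝ)) := (BddMeas.const 1).indicator (hT0 k)
    calc ∑ i ∈ Finset.range N, ∑ j ∈ Finset.range N, ∫ ω, y k i j ω ^ 2 ∂μ
        ≤ ∑ i ∈ Finset.range N, ∑ j ∈ Finset.range N,
            2 * ∫ ω, (U k)ᶜ.indicator (fun ω => y k i j ω ^ 2) ω ∂μ :=
          Finset.sum_le_sum fun i _ => Finset.sum_le_sum fun j _ => h1 i j
      _ = 2 * ∫ ω, ∑ i ∈ Finset.range N, ∑ j ∈ Finset.range N,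
            (U k)ᶜ.indicator (fun ω => y k i j ω ^ 2) ω ∂μ := by
          rw [BddMeas.integral_sum _ fun i _ => BddMeas.sum _ fun j _ => hI i j, Finset.mul_sum]
          refine Finset.sum_congr rfl fun i _ => ?_
          rw [BddMeas.integral_sum _ fun j _ => hI i j, Finset.mul_sum]
      _ ≤ 2 * ∫ ω, lam k ^ 2 * (T k N N).indicator (1 : Ω → ℝ) ω ∂μ := by
          refine mul_le_mul_of_nonneg_left (BddMeas.integral_mono
            (BddMeas.sum _ fun i _ => BddMeas.sum _ fun j _ => hI i j)
            (h1T.const_mul _) ?_) zero_le_two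
          filter_upwards [hSe] with ω hω
          by_cases hωU : ω ∈ U k
          · simp only [Set.mem_compl_iff, hωU, not_true_eq_false, not_false_eq_true,
              Set.indicator_of_notMem, Finset.sum_const_zero]
            exact mul_nonneg (sq_nonneg _) (Set.indicator_nonneg (fun _ _ => zero_le_one) _)
          simp only [Set.mem_compl_iff, hωU, not_false_eq_true, Set.indicator_of_mem]
          by_cases hωT : ω ∈ T k N N
          · simp only [hωT, Set.indicator_of_mem, Pi.one_apply, mul_one]
            have h2 : sqFun d N ω ≤ lam k := by rw [hω]; exact not_lt.1 hωU
            have h3 : sqFun d N ω ^ 2 =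
                ∑ i ∈ Finset.range N, ∑ j ∈ Finset.range N, d i j ω ^ 2 :=
              Real.sq_sqrt (Finset.sum_nonneg fun i _ => Finset.sum_nonneg fun j _ => sq_nonneg _)
            refine le_trans (Finset.sum_le_sum fun i _ => Finset.sum_le_sum fun j _ =>
              sq_le_sq.2 (norm_indicator_le_norm_self (d i j) ω)) ?_
            rw [← h3]
            exact pow_le_pow_left₀ (Real.sqrt_nonneg _) h2 2
          · refine le_of_eq ?_
            rw [Set.indicator_of_notMem hωT, mul_zero]
            refine Finset.sum_eq_zero fun i hi => Finset.sum_eq_zero fun j hj => ?_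
            by_contra h0
            exact hωT (layer_mono k (Finset.mem_range.1 hi) (Finset.mem_range.1 hj)
              (hmem k i j ω fun h1 => h0 (by rw [h1]; ring)).1)
      _ = 2 * (lam k ^ 2 * μ.real (T k N N)) := by
          rw [integral_const_mul, integral_indicator_one (hT0 k)]
  choose G hG hle hi using fun k => h.exists_dom_rectSum_of_support (hy k) (hT k)
    (fun _ _ _ _ h1 h2 => layer_mono k h1 h2) (fun i j ω h0 => (hmem k i j ω h0).1) N (hlam k)
  refine ⟨fun ω => ∑ k ∈ Finset.range (K + 1), G k ω, BddMeas.sum _ fun k _ => hG k, ?_, ?_⟩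
  · have hdec : ∀ i j, ∀ᵐ ω ∂μ, i < N → j < N →
        d i j ω = ∑ k ∈ Finset.range (K + 1), rectInc μ R C F i j (y k i j) ω := by
      intro i j
      by_cases hij : i < N ∧ j < N
      · have h1 : d i j =ᵐ[μ] fun ω => ∑ k ∈ Finset.range (K + 1), y k i j ω := by
          filter_upwards [hTK] with ω hω
          rw [sum_indicator_layer, Set.indicator_of_notMem fun hm =>
            hω (layer_mono _ hij.1 hij.2 hm), sub_zero]
        filter_upwards [h.rectInc_eq_self (hd0 i j) (hdR i j) (hdC i j),
          rectInc_congr (R := R) (C := C) (F := F) h1 i j,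
          rectInc_sum (R := R) (C := C) (F := F) (fun k => hy0 k i j) i j (K + 1)]
          with ω h1 h2 h3 _ _
        rw [← h1, h2, h3]
      · exact .of_forall fun ω h1 h2 => absurd ⟨h1, h2⟩ hij
    filter_upwards [ae_all_iff.2 fun i => ae_all_iff.2 (hdec i), ae_all_iff.2 hle]
      with ω hdec hle n hn m hm
    have e : ∑ i ∈ Finset.range n, ∑ j ∈ Finset.range m, d i j ω =
        ∑ k ∈ Finset.range (K + 1), rectSum μ R C F (y k) n m ω := by
      simp only [rectSum]
      symm
      rw [Finset.sum_comm]
      refine Finset.sum_congr rfl fun i hi => ?_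
      rw [Finset.sum_comm]
      exact Finset.sum_congr rfl fun j hj => (hdec i j
        ((Finset.mem_range.1 hi).trans_le hn) ((Finset.mem_range.1 hj).trans_le hm)).symm
    rw [e]
    exact (Finset.abs_sum_le_sum_abs _ _).trans (Finset.sum_le_sum fun k _ => hle k n hn m hm)
  · rw [BddMeas.integral_sum _ fun k _ => hG k]
    have h1 : ∀ k, ∫ ω, G k ω ∂μ ≤ 1200 * (lam k * μ.real (T k N N)) := by
      intro k
      have h2 : (lam k)⁻¹ * ∑ i ∈ Finset.range N, ∑ j ∈ Finset.range N, ∫ ω, y k i j ω ^ 2 ∂μ ≤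
          (lam k)⁻¹ * (2 * (lam k ^ 2 * μ.real (T k N N))) :=
        mul_le_mul_of_nonneg_left (hsq k) (inv_pos.2 (hlam k)).le
      have h3 : (lam k)⁻¹ * (2 * (lam k ^ 2 * μ.real (T k N N))) =
          2 * (lam k * μ.real (T k N N)) := by
        have := (hlam k).ne'
        field_simp
      linarith [hi k]
    have h1U : ∀ k, BddMeas μ m0 ((U k).indicator (1 : Ω → ℝ)) := fun k =>
      (BddMeas.const 1).indicator (hU k)
    have h4 : ∑ k ∈ Finset.range K, lam k * μ.real (U k) ≤ 2 * ∫ ω, sqFun d N ω ∂μ := by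
      have h5 : ∑ k ∈ Finset.range K, lam k * μ.real (U k) =
          ∫ ω, ∑ k ∈ Finset.range K, lam k * (U k).indicator (1 : Ω → ℝ) ω ∂μ := by
        rw [BddMeas.integral_sum _ fun k _ => (h1U k).const_mul (lam k)]
        simp only [integral_const_mul, integral_indicator_one (hU _)]
      rw [h5, ← integral_const_mul]
      refine BddMeas.integral_mono (BddMeas.sum _ fun k _ => (h1U k).const_mul (lam k))
        (hS.const_mul 2) ?_
      filter_upwards [hSe] with ω hω
      have hS0 : 0 ≤ S ω := hω ▸ Real.sqrt_nonneg _
      rw [hω]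
      refine le_trans (le_of_eq (Finset.sum_congr rfl fun k _ => ?_))
        (sum_dyadic_levels_le hS0 hε.le K)
      by_cases hk : ω ∈ U k
      · have hk' : ε * 2 ^ k < S ω := hk
        simp [hk, hk', lam]
      · have hk' : ¬ ε * 2 ^ k < S ω := hk
        simp [hk, hk']
    calc ∑ k ∈ Finset.range (K + 1), ∫ ω, G k ω ∂μ
        ≤ ∑ k ∈ Finset.range (K + 1), 1200 * (lam k * μ.real (T k N N)) :=
          Finset.sum_le_sum fun k _ => h1 k
      _ = ∑ k ∈ Finset.range K, 1200 * (lam (k + 1) * μ.real (T (k + 1) N N)) +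
            1200 * (ε * μ.real Set.univ) := by
          rw [Finset.sum_range_succ']
          simp [lam, T, layer]
      _ ≤ ∑ k ∈ Finset.range K, 153600 * (lam k * μ.real (U k)) +
            1200 * (ε * μ.real Set.univ) := by
          refine add_le_add_left (Finset.sum_le_sum fun k _ => ?_) _
          have h6 : lam (k + 1) = 2 * lam k := by simp only [lam, pow_succ]; ring
          have h7 := mul_le_mul_of_nonneg_left (hTμ k) (hlam k).le
          rw [h6]
          linarith
      _ ≤ _ := by
          rw [← Finset.mul_sum]
          linarith

end IsCommutingGrid

section SqFun

variable {Ω : Type*} {m0 : MeasurableSpace Ω} {μ : Measure Ω}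

theorem sqFun_nonneg (y : ℕ → ℕ → Ω → ℝ) (N : ℕ) (ω : Ω) : 0 ≤ sqFun y N ω := Real.sqrt_nonneg _

theorem sqFun_eq_norm (y : ℕ → ℕ → Ω → ℝ) (N : ℕ) (ω : Ω) :
    sqFun y N ω = ‖(WithLp.toLp 2 fun p : Fin N × Fin N => y p.1 p.2 ω :
      EuclideanSpace ℝ (Fin N × Fin N))‖ := by
  rw [EuclideanSpace.norm_eq, sqFun, Fintype.sum_prod_type, Finset.sum_range]
  simp [Finset.sum_range]

theorem sqFun_le_add (y z : ℕ → ℕ → Ω → ℝ) (N : ℕ) (ω : Ω) :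
    sqFun y N ω ≤ sqFun z N ω + sqFun (fun i j ω => y i j ω - z i j ω) N ω := by
  simp only [sqFun_eq_norm]
  refine le_trans (le_of_eq ?_) (norm_add_le _ _)
  congr 1
  ext p
  simp

theorem sqFun_le_sum_abs (y : ℕ → ℕ → Ω → ℝ) (N : ℕ) (ω : Ω) :
    sqFun y N ω ≤ ∑ i ∈ Finset.range N, ∑ j ∈ Finset.range N, |y i j ω| := by
  set T := ∑ i ∈ Finset.range N, ∑ j ∈ Finset.range N, |y i j ω| with hT
  have hT0 : 0 ≤ T := Finset.sum_nonneg fun i _ => Finset.sum_nonneg fun j _ => abs_nonneg _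
  refine Real.sqrt_le_iff.2 ⟨hT0, ?_⟩
  have h1 : ∀ i ∈ Finset.range N, ∀ j ∈ Finset.range N, y i j ω ^ 2 ≤ |y i j ω| * T := by
    intro i hi j hj
    have h2 : |y i j ω| ≤ T :=
      (Finset.single_le_sum (f := fun j => |y i j ω|) (fun j _ => abs_nonneg _) hj).trans
        (Finset.single_le_sum (f := fun i => ∑ j ∈ Finset.range N, |y i j ω|)
          (fun i _ => Finset.sum_nonneg fun j _ => abs_nonneg _) hi)
    rw [← sq_abs, sq]
    exact mul_le_mul_of_nonneg_left h2 (abs_nonneg _)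
  refine (Finset.sum_le_sum fun i hi => Finset.sum_le_sum (h1 i hi)).trans (le_of_eq ?_)
  simp only [← Finset.sum_mul]
  rw [← hT, sq]

theorem abs_le_sqFun (y : ℕ → ℕ → Ω → ℝ) {N i j : ℕ} (hi : i < N) (hj : j < N) (ω : Ω) :
    |y i j ω| ≤ sqFun y N ω := by
  rw [← Real.sqrt_sq_eq_abs]
  refine Real.sqrt_le_sqrt ?_
  exact (Finset.single_le_sum (f := fun j => y i j ω ^ 2) (fun j _ => sq_nonneg _)
    (Finset.mem_range.2 hj)).trans
    (Finset.single_le_sum (f := fun i => ∑ j ∈ Finset.range N, y i j ω ^ 2)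
      (fun i _ => Finset.sum_nonneg fun j _ => sq_nonneg _) (Finset.mem_range.2 hi))

theorem integrable_sqFun {y : ℕ → ℕ → Ω → ℝ} (hy : ∀ i j, Integrable (y i j) μ) (N : ℕ) :
    Integrable (sqFun y N) μ := by
  refine Integrable.mono' (integrable_finsetSum (Finset.range N) fun i _ =>
    integrable_finsetSum (Finset.range N) fun j _ => (hy i j).abs) ?_ (.of_forall fun ω => ?_)
  · exact Real.continuous_sqrt.comp_aestronglyMeasurable
      (Finset.aestronglyMeasurable_fun_sum _ fun i _ =>
        Finset.aestronglyMeasurable_fun_sum _ fun j _ => (hy i j).1.pow 2)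
  · rw [Real.norm_of_nonneg (sqFun_nonneg _ _ _)]
    exact sqFun_le_sum_abs y N ω

end SqFun

/-- The rectangular differences of the conditional expectations of `f`. -/
noncomputable def rectDiff {Ω : Type*} {m0 : MeasurableSpace Ω} (μ : Measure Ω)
    (F : ℕ → ℕ → MeasurableSpace Ω) (f : Ω → ℝ) (i j : ℕ) (ω : Ω) : ℝ :=
  ((μ[f|F (i + 1) (j + 1)]) ω - (μ[f|F i (j + 1)]) ω) -
    ((μ[f|F (i + 1) j]) ω - (μ[f|F i j]) ω)

theorem integrable_rectDiff {Ω : Type*} {m0 : MeasurableSpace Ω} (μ : Measure Ω)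
    (F : ℕ → ℕ → MeasurableSpace Ω) (f : Ω → ℝ) (i j : ℕ) : Integrable (rectDiff μ F f i j) μ :=
  (integrable_condExp.sub integrable_condExp).sub (integrable_condExp.sub integrable_condExp)

theorem sum_rectDiff {Ω : Type*} {m0 : MeasurableSpace Ω} (μ : Measure Ω)
    (F : ℕ → ℕ → MeasurableSpace Ω) (f : Ω → ℝ) (n m : ℕ) (ω : Ω) :
    ∑ i ∈ Finset.range n, ∑ j ∈ Finset.range m, rectDiff μ F f i j ω =
      ((μ[f|F n m]) ω - (μ[f|F 0 m]) ω) - ((μ[f|F n 0]) ω - (μ[f|F 0 0]) ω) := by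
  have h1 : ∀ i, ∑ j ∈ Finset.range m, rectDiff μ F f i j ω =
      ((μ[f|F (i + 1) m]) ω - (μ[f|F i m]) ω) - ((μ[f|F (i + 1) 0]) ω - (μ[f|F i 0]) ω) :=
    fun i => Finset.sum_range_sub (fun j => (μ[f|F (i + 1) j]) ω - (μ[f|F i j]) ω) m
  simp only [h1]
  rw [Finset.sum_sub_distrib, Finset.sum_range_sub (fun i => (μ[f|F i m]) ω),
    Finset.sum_range_sub (fun i => (μ[f|F i 0]) ω)]

namespace IsCommutingGrid

variable {Ω : Type*} {m0 : MeasurableSpace Ω} {μ : Measure Ω} {R C : Filtration ℕ m0}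
  {F : ℕ → ℕ → MeasurableSpace Ω}

theorem rectDiff_symm (f : Ω → ℝ) (i j : ℕ) :
    rectDiff μ (fun j i => F i j) f j i = rectDiff μ F f i j := by
  ext ω; simp only [rectDiff]; ring

section

variable [IsFiniteMeasure μ]

theorem condExp_row_rectDiff (h : IsCommutingGrid μ R C F) {f : Ω → ℝ} (hf : BddMeas μ m0 f)
    (i j : ℕ) : μ[rectDiff μ F f i j|R i] =ᵐ[μ] fun _ => 0 := by
  have hE : ∀ k l, BddMeas μ m0 (μ[f|F k l]) := fun k l => hf.condExp'
  have h1 : ∀ k l, i ≤ k → μ[μ[f|F k l]|R i] =ᵐ[μ] μ[f|F i l] := fun k l hk =>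
    (h.condExp_row_eq (hf.condExp (m := F k l)) i).trans
      (condExp_condExp_of_le (h.mono hk le_rfl) (h.le k l))
  filter_upwards [BddMeas.condExp_sub (m := R i) ((hE (i + 1) (j + 1)).sub (hE i (j + 1)))
      ((hE (i + 1) j).sub (hE i j)),
    BddMeas.condExp_sub (m := R i) (hE (i + 1) (j + 1)) (hE i (j + 1)),
    BddMeas.condExp_sub (m := R i) (hE (i + 1) j) (hE i j), h1 (i + 1) (j + 1) i.le_succ,
    h1 i (j + 1) le_rfl, h1 (i + 1) j i.le_succ, h1 i j le_rfl] with ω a1 a2 a3 a4 a5 a6 a7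
  refine a1.trans ?_
  rw [a2, a3, a4, a5, a6, a7]
  ring

theorem bddMeas_rectDiff (h : IsCommutingGrid μ R C F) {f : Ω → ℝ} (hf : BddMeas μ m0 f)
    (i j : ℕ) : BddMeas μ (F (i + 1) (j + 1)) (rectDiff μ F f i j) := by
  have hE : ∀ k l, k ≤ i + 1 → l ≤ j + 1 → BddMeas μ (F (i + 1) (j + 1)) (μ[f|F k l]) :=
    fun k l hk hl => BddMeas.mono hf.condExp (h.mono hk hl)
  exact ((hE _ _ le_rfl le_rfl).sub (hE _ _ i.le_succ le_rfl)).sub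
    ((hE _ _ le_rfl j.le_succ).sub (hE _ _ i.le_succ j.le_succ))

end

variable [IsProbabilityMeasure μ]

theorem exists_dom_condExp_of_bdd (h : IsCommutingGrid μ R C F)
    (hbot : ∀ i j, i = 0 ∨ j = 0 → F i j = ⊥) {f : Ω → ℝ} (hf : BddMeas μ m0 f) (N : ℕ) {ε : ℝ}
    (hε : 0 < ε) :
    ∃ G : Ω → ℝ, Integrable G μ ∧
      (∀ᵐ ω ∂μ, ∀ n ≤ N, ∀ m ≤ N, |(μ[f|F n m]) ω - ∫ x, f x ∂μ| ≤ G ω) ∧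
      ∫ ω, G ω ∂μ ≤ 307200 * ∫ ω, sqFun (rectDiff μ F f) N ω ∂μ + ε := by
  have hC : ∀ i j, μ[rectDiff μ F f i j|C j] =ᵐ[μ] fun _ => 0 := fun i j => by
    have := h.symm.condExp_row_rectDiff hf j i
    rwa [rectDiff_symm] at this
  obtain ⟨G, hG, hle, hi⟩ := h.exists_dom_sum (h.bddMeas_rectDiff hf)
    (h.condExp_row_rectDiff hf) hC N (ε := ε / 1200) (by positivity)
  refine ⟨G, hG.integrable, ?_, ?_⟩
  · filter_upwards [hle] with ω h1 n hn m hm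
    have h2 := h1 n hn m hm
    rw [sum_rectDiff, hbot 0 m (.inl rfl), hbot n 0 (.inr rfl), hbot 0 0 (.inl rfl)] at h2
    simpa [condExp_bot] using h2
  · simp only [probReal_univ] at hi
    linarith

theorem exists_dom_condExp (h : IsCommutingGrid μ R C F)
    (hbot : ∀ i j, i = 0 ∨ j = 0 → F i j = ⊥) {f : Ω → ℝ} (hf : Integrable f μ) (N : ℕ) {ε : ℝ}
    (hε : 0 < ε) :
    ∃ G : Ω → ℝ, Integrable G μ ∧
      (∀ᵐ ω ∂μ, ∀ n ≤ N, ∀ m ≤ N, |(μ[f|F n m]) ω - ∫ x, f x ∂μ| ≤ G ω) ∧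
      ∫ ω, G ω ∂μ ≤ 307200 * ∫ ω, sqFun (rectDiff μ F f) N ω ∂μ + ε := by
  let A : ℝ := 2 * (N + 1) ^ 2 + 307200 * (4 * N ^ 2)
  have hA : 0 < A := by positivity
  let δ : ℝ := ε / 2 / A
  have hδ : 0 < δ := by positivity
  obtain ⟨g, hg1, -⟩ := (memLp_one_iff_integrable.2 hf).exists_simpleFunc_eLpNorm_sub_lt
    one_ne_top (ε := ENNReal.ofReal δ) (by simpa using hδ)
  have hgb : BddMeas μ m0 g := by
    obtain ⟨K, hK⟩ := g.exists_forall_norm_le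
    exact ⟨g.aestronglyMeasurable, K, .of_forall hK⟩
  have hgi := hgb.integrable
  have hr : Integrable (f - ⇑g) μ := hf.sub hgi
  have hr1 : ∫ ω, |(f - ⇑g) ω| ∂μ ≤ δ := by
    have h1 : ∫ ω, |(f - ⇑g) ω| ∂μ = (eLpNorm (f - ⇑g) 1 μ).toReal := by
      rw [eLpNorm_one_eq_lintegral_enorm, ← integral_norm_eq_lintegral_enorm hr.1]
      rfl
    rw [h1]
    exact ENNReal.toReal_le_of_le_ofReal hδ.le hg1.le
  have hE1 : ∀ n m, ∫ ω, |(μ[f - ⇑g|F n m]) ω| ∂μ ≤ δ := fun n m =>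
    (integral_abs_condExp_le (f - ⇑g)).trans hr1
  have hEs : ∀ n m, μ[f - ⇑g|F n m] =ᵐ[μ] μ[f|F n m] - μ[⇑g|F n m] := fun n m =>
    MeasureTheory.condExp_sub hf hgi _
  have hIs : ∫ ω, (f - ⇑g) ω ∂μ = ∫ ω, f ω ∂μ - ∫ ω, g ω ∂μ := integral_sub hf hgi
  obtain ⟨G, hG, hle, hi⟩ := h.exists_dom_condExp_of_bdd hbot hgb N (ε := ε / 2) (by positivity)
  have hei : ∀ n m, Integrable (fun ω => |(μ[f - ⇑g|F n m]) ω| + δ) μ := fun n m =>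
    integrable_condExp.abs.add (integrable_const δ)
  have hEi : Integrable (fun ω => ∑ n ∈ Finset.range (N + 1), ∑ m ∈ Finset.range (N + 1),
      (|(μ[f - ⇑g|F n m]) ω| + δ)) μ :=
    integrable_finsetSum _ fun n _ => integrable_finsetSum _ fun m _ => hei n m
  refine ⟨fun ω => G ω + ∑ n ∈ Finset.range (N + 1), ∑ m ∈ Finset.range (N + 1),
    (|(μ[f - ⇑g|F n m]) ω| + δ), hG.add hEi, ?_, ?_⟩
  · filter_upwards [hle, ae_all_iff.2 fun n => ae_all_iff.2 fun m => hEs n m]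
      with ω h1 h2 n hn m hm
    have h3 : |(μ[f - ⇑g|F n m]) ω| + δ ≤ ∑ n ∈ Finset.range (N + 1),
        ∑ m ∈ Finset.range (N + 1), (|(μ[f - ⇑g|F n m]) ω| + δ) :=
      (Finset.single_le_sum (f := fun m => |(μ[f - ⇑g|F n m]) ω| + δ)
        (fun m _ => by positivity) (Finset.mem_range.2 (Nat.lt_succ_of_le hm))).trans
      (Finset.single_le_sum (f := fun n => ∑ m ∈ Finset.range (N + 1),
        (|(μ[f - ⇑g|F n m]) ω| + δ)) (fun n _ => Finset.sum_nonneg fun m _ => by positivity)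
        (Finset.mem_range.2 (Nat.lt_succ_of_le hn)))
    have h4 := h2 n m
    rw [Pi.sub_apply] at h4
    have h5 : |∫ ω, (f - ⇑g) ω ∂μ| ≤ δ := abs_integral_le_integral_abs.trans hr1
    have e : (μ[f|F n m]) ω - ∫ x, f x ∂μ = ((μ[⇑g|F n m]) ω - ∫ x, g x ∂μ) +
        ((μ[f - ⇑g|F n m]) ω - ∫ ω, (f - ⇑g) ω ∂μ) := by rw [h4, hIs]; ring
    rw [e]
    refine (abs_add_le _ _).trans (add_le_add (h1 n hn m hm) (le_trans ?_ h3))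
    exact (abs_sub _ _).trans (by gcongr)
  · have hD : ∀ i j, (fun ω => rectDiff μ F g i j ω - rectDiff μ F f i j ω) =ᵐ[μ]
        fun ω => -rectDiff μ F (f - ⇑g) i j ω := by
      intro i j
      filter_upwards [hEs (i + 1) (j + 1), hEs i (j + 1), hEs (i + 1) j, hEs i j]
        with ω h1 h2 h3 h4
      simp only [rectDiff, h1, h2, h3, h4, Pi.sub_apply]
      ring
    have hD1 : ∀ i j, ∫ ω, |rectDiff μ F g i j ω - rectDiff μ F f i j ω| ∂μ ≤ 4 * δ := by
      intro i j
      have hc : ∀ n m, Integrable (fun ω => |(μ[f - ⇑g|F n m]) ω|) μ := fun n m =>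
        integrable_condExp.abs
      have hc2 : ∀ n m k l, Integrable
          (fun ω => |(μ[f - ⇑g|F n m]) ω| + |(μ[f - ⇑g|F k l]) ω|) μ :=
        fun n m k l => (hc n m).add (hc k l)
      have h1 : ∫ ω, |rectDiff μ F g i j ω - rectDiff μ F f i j ω| ∂μ ≤
          ∫ ω, ((|(μ[f - ⇑g|F (i + 1) (j + 1)]) ω| + |(μ[f - ⇑g|F i (j + 1)]) ω|) +
            (|(μ[f - ⇑g|F (i + 1) j]) ω| + |(μ[f - ⇑g|F i j]) ω|)) ∂μ := by
        refine integral_mono_ae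
          ((integrable_rectDiff μ F g i j).sub (integrable_rectDiff μ F f i j)).abs
          ((hc2 _ _ _ _).add (hc2 _ _ _ _)) ?_
        filter_upwards [hD i j] with ω hω
        rw [hω, abs_neg, rectDiff]
        exact (abs_sub _ _).trans (add_le_add (abs_sub _ _) (abs_sub _ _))
      rw [integral_add (hc2 _ _ _ _) (hc2 _ _ _ _),
        integral_add (hc _ _) (hc _ _), integral_add (hc _ _) (hc _ _)] at h1
      linarith [hE1 (i + 1) (j + 1), hE1 i (j + 1), hE1 (i + 1) j, hE1 i j]
    have hDi : ∀ i j, Integrable (fun ω => |rectDiff μ F g i j ω - rectDiff μ F f i j ω|) μ :=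
      fun i j => ((integrable_rectDiff μ F g i j).sub (integrable_rectDiff μ F f i j)).abs
    have hSf := integrable_sqFun (integrable_rectDiff μ F f) N
    have hDs : Integrable (fun ω => ∑ i ∈ Finset.range N, ∑ j ∈ Finset.range N,
        |rectDiff μ F g i j ω - rectDiff μ F f i j ω|) μ :=
      integrable_finsetSum _ fun i _ => integrable_finsetSum _ fun j _ => hDi i j
    have hS : ∫ ω, sqFun (rectDiff μ F g) N ω ∂μ ≤
        ∫ ω, sqFun (rectDiff μ F f) N ω ∂μ + 4 * N ^ 2 * δ := by
      have h1 : ∫ ω, sqFun (rectDiff μ F g) N ω ∂μ ≤ ∫ ω, (sqFun (rectDiff μ F f) N ω +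
          ∑ i ∈ Finset.range N, ∑ j ∈ Finset.range N,
            |rectDiff μ F g i j ω - rectDiff μ F f i j ω|) ∂μ :=
        integral_mono (integrable_sqFun (integrable_rectDiff μ F g) N) (hSf.add hDs) fun ω =>
          (sqFun_le_add _ (rectDiff μ F f) N ω).trans (by gcongr; exact sqFun_le_sum_abs _ N ω)
      rw [integral_add hSf hDs, integral_finsetSum _
        fun i _ => integrable_finsetSum _ fun j _ => hDi i j] at h1
      simp only [integral_finsetSum _ fun j _ => hDi _ j] at h1
      have h2 : ∑ i ∈ Finset.range N, ∑ j ∈ Finset.range N,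
          ∫ ω, |rectDiff μ F g i j ω - rectDiff μ F f i j ω| ∂μ ≤
          ∑ i ∈ Finset.range N, ∑ j ∈ Finset.range N, 4 * δ :=
        Finset.sum_le_sum fun i _ => Finset.sum_le_sum fun j _ => hD1 i j
      simp only [Finset.sum_const, Finset.card_range, nsmul_eq_mul] at h2
      linarith
    have hEl : ∫ ω, ∑ n ∈ Finset.range (N + 1), ∑ m ∈ Finset.range (N + 1),
        (|(μ[f - ⇑g|F n m]) ω| + δ) ∂μ ≤ 2 * (N + 1) ^ 2 * δ := by
      rw [integral_finsetSum _ fun i _ => integrable_finsetSum _ fun j _ => hei i j]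
      simp only [integral_finsetSum _ fun j _ => hei _ j]
      have h2 : ∑ n ∈ Finset.range (N + 1), ∑ m ∈ Finset.range (N + 1),
          ∫ ω, (|(μ[f - ⇑g|F n m]) ω| + δ) ∂μ ≤
          ∑ n ∈ Finset.range (N + 1), ∑ m ∈ Finset.range (N + 1), 2 * δ := by
        refine Finset.sum_le_sum fun n _ => Finset.sum_le_sum fun m _ => ?_
        rw [integral_add integrable_condExp.abs (integrable_const δ), integral_const]
        simp only [probReal_univ, one_smul]
        linarith [hE1 n m]
      simp only [Finset.sum_const, Finset.card_range, nsmul_eq_mul, Nat.cast_add,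
        Nat.cast_one] at h2
      linarith
    have hAδ : A * δ = ε / 2 := mul_div_cancel₀ _ hA.ne'
    rw [integral_add hG hEi]
    have : A * δ = 2 * (N + 1) ^ 2 * δ + 307200 * (4 * N ^ 2 * δ) := by simp only [A]; ring
    linarith

end IsCommutingGrid

/-- If `𝔼[𝔼[g | 𝒢 k] | m]` is eventually equal to `q`, then `𝔼[𝔼[g | ⨆ k, 𝒢 k] | m] = q`. -/
theorem condExp_condExp_iSup_of_eventually {Ω : Type*} {m m0 : MeasurableSpace Ω} {μ : Measure Ω}
    [IsFiniteMeasure μ] (𝒢 : Filtration ℕ m0) {g q : Ω → ℝ} (K : ℕ)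
    (h : ∀ k ≥ K, μ[μ[g|𝒢 k]|m] =ᵐ[μ] q) : μ[μ[g|⨆ k, 𝒢 k]|m] =ᵐ[μ] q := by
  have hq : AEStronglyMeasurable q μ := integrable_condExp.1.congr (h K le_rfl)
  have h0 : eLpNorm (q - μ[μ[g|⨆ k, 𝒢 k]|m]) 1 μ ≤ 0 := by
    refine ge_of_tendsto (tendsto_eLpNorm_condExp (μ := μ) (ℱ := 𝒢) g)
      (Filter.eventually_atTop.2 ⟨K, fun k hk => ?_⟩)
    have hsub : μ[μ[g|𝒢 k] - μ[g|⨆ k, 𝒢 k]|m] =ᵐ[μ] q - μ[μ[g|⨆ k, 𝒢 k]|m] :=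
      (MeasureTheory.condExp_sub integrable_condExp integrable_condExp m).trans
        ((h k hk).sub .rfl)
    exact (eLpNorm_congr_ae hsub).symm.le.trans (eLpNorm_condExp_le_eLpNorm _ le_rfl)
  have h1 := (eLpNorm_eq_zero_iff (hq.sub integrable_condExp.1) one_ne_zero).1
    (le_antisymm h0 bot_le)
  filter_upwards [h1] with ω hω
  exact (sub_eq_zero.1 hω).symm

namespace IsF4Filtration

variable {Ω : Type*} [m0 : MeasurableSpace Ω] {μ : Measure Ω} {𝓕 : ℕ → ℕ → MeasurableSpace Ω}

theorem transpose (h : IsF4Filtration μ 𝓕) : IsF4Filtration μ (fun j i => 𝓕 i j) :=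
  ⟨fun i j => h.le j i, fun i j => h.mono_right j i, fun i j => h.mono_left j i,
    fun i j k l => h.f4 j i l k⟩

theorem mono (h : IsF4Filtration μ 𝓕) {i k j l : ℕ} (hik : i ≤ k) (hjl : j ≤ l) :
    𝓕 i j ≤ 𝓕 k l :=
  (monotone_nat_of_le_succ (f := fun i => 𝓕 i j) (fun i => h.mono_left i j) hik).trans
    (monotone_nat_of_le_succ (f := 𝓕 k) (h.mono_right k) hjl)

/-- The row filtration `(ℱ_{i,∞})_i`. -/
def rowFiltration (h : IsF4Filtration μ 𝓕) : Filtration ℕ m0 where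
  seq := rowSup 𝓕
  mono' _ _ hik := iSup_mono fun _ => h.mono hik le_rfl
  le' i := iSup_le fun j => h.le i j

/-- The column filtration `(ℱ_{∞,j})_j`. -/
def colFiltration (h : IsF4Filtration μ 𝓕) : Filtration ℕ m0 := h.transpose.rowFiltration

theorem condExp_row_col [IsFiniteMeasure μ] (h : IsF4Filtration μ 𝓕) (i j : ℕ) {f : Ω → ℝ}
    (hf : Integrable f μ) : μ[μ[f|colSup 𝓕 j]|rowSup 𝓕 i] =ᵐ[μ] μ[f|𝓕 i j] := by
  let 𝒞 : Filtration ℕ m0 := ⟨fun k => 𝓕 k j, fun _ _ hk => h.mono hk le_rfl, fun k => h.le k j⟩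
  let ℛ : Filtration ℕ m0 := ⟨fun l => 𝓕 i l, fun _ _ hl => h.mono le_rfl hl, fun l => h.le i l⟩
  have hC : ∀ l ≥ j, μ[μ[f|colSup 𝓕 j]|𝓕 i l] =ᵐ[μ] μ[f|𝓕 i j] := fun l hl =>
    condExp_condExp_iSup_of_eventually 𝒞 i fun k hk => by
      have := h.f4 i l k j f hf
      rwa [min_eq_left hk, min_eq_right hl] at this
  have hconv := tendsto_eLpNorm_condExp (ℱ := ℛ) (μ := μ) (μ[f|colSup 𝓕 j])
  have h0 : eLpNorm (μ[f|𝓕 i j] - μ[μ[f|colSup 𝓕 j]|rowSup 𝓕 i]) 1 μ ≤ 0 := by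
    refine ge_of_tendsto hconv (Filter.eventually_atTop.2 ⟨j, fun l hl => ?_⟩)
    exact (eLpNorm_congr_ae ((hC l hl).symm.sub .rfl)).le
  have h1 := (eLpNorm_eq_zero_iff (integrable_condExp.1.sub integrable_condExp.1)
    one_ne_zero).1 (le_antisymm h0 bot_le)
  filter_upwards [h1] with ω hω
  exact (sub_eq_zero.1 hω).symm

theorem isCommutingGrid [IsFiniteMeasure μ] (h : IsF4Filtration μ 𝓕) :
    IsCommutingGrid μ h.rowFiltration h.colFiltration 𝓕 where
  le_row i j := le_iSup (𝓕 i) j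
  le_col i j := le_iSup (fun i => 𝓕 i j) i
  mono := h.mono
  row_col i j _ hf := h.condExp_row_col i j hf
  col_row i j _ hf := h.transpose.condExp_row_col j i hf

end IsF4Filtration

/-- The array `𝓕` preceded by a trivial row and a trivial column. -/
@[reducible] def padBot {Ω : Type*} (𝓕 : ℕ → ℕ → MeasurableSpace Ω) : ℕ → ℕ → MeasurableSpace Ω
  | i + 1, j + 1 => 𝓕 i j
  | _, _ => ⊥

theorem padBot_eq_bot {Ω : Type*} (𝓕 : ℕ → ℕ → MeasurableSpace Ω) (i j : ℕ)
    (h : i = 0 ∨ j = 0) : padBot 𝓕 i j = ⊥ := by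
  rcases h with rfl | rfl
  · rfl
  · cases i <;> rfl

section Padding

variable {Ω : Type*} [m0 : MeasurableSpace Ω] {μ : Measure Ω} [IsProbabilityMeasure μ]
  {𝓕 : ℕ → ℕ → MeasurableSpace Ω}

theorem IsF4Filtration.padBot (h : IsF4Filtration μ 𝓕) : IsF4Filtration μ (padBot 𝓕) where
  le i j := by
    cases i <;> cases j <;> first | exact bot_le | exact h.le _ _
  mono_left i j := by
    cases i <;> cases j <;> first | exact bot_le | exact h.mono_left _ _
  mono_right i j := by
    cases i <;> cases j <;> first | exact bot_le | exact h.mono_right _ _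
  f4 i j k l f hf := by
    by_cases hkl : k = 0 ∨ l = 0
    · rw [padBot_eq_bot 𝓕 k l hkl, padBot_eq_bot 𝓕 (min i k) (min j l) (by omega), condExp_bot]
      by_cases hij : i = 0 ∨ j = 0
      · rw [padBot_eq_bot 𝓕 i j hij, condExp_const bot_le]
      · obtain ⟨i, rfl⟩ := Nat.exists_eq_succ_of_ne_zero (fun hi => hij (.inl hi))
        obtain ⟨j, rfl⟩ := Nat.exists_eq_succ_of_ne_zero (fun hj => hij (.inr hj))
        exact .of_eq (condExp_const (h.le i j) _)
    · obtain ⟨k, rfl⟩ := Nat.exists_eq_succ_of_ne_zero (fun hk => hkl (.inl hk))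
      obtain ⟨l, rfl⟩ := Nat.exists_eq_succ_of_ne_zero (fun hl => hkl (.inr hl))
      by_cases hij : i = 0 ∨ j = 0
      · rw [padBot_eq_bot 𝓕 i j hij, padBot_eq_bot 𝓕 (min i _) (min j _) (by omega), condExp_bot,
          condExp_bot]
        simp only [_root_.padBot, integral_condExp (h.le k l)]
        rfl
      · obtain ⟨i, rfl⟩ := Nat.exists_eq_succ_of_ne_zero (fun hi => hij (.inl hi))
        obtain ⟨j, rfl⟩ := Nat.exists_eq_succ_of_ne_zero (fun hj => hij (.inr hj))
        rw [Nat.succ_min_succ, Nat.succ_min_succ]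
        exact h.f4 i j k l f hf

theorem dd_ae_eq_rectDiff (h : IsF4Filtration μ 𝓕) {f : Ω → ℝ} (hf : Integrable f μ) (i j : ℕ) :
    dd μ 𝓕 i j f =ᵐ[μ]
      fun ω => rectDiff μ (padBot 𝓕) f i j ω + if i = 0 ∧ j = 0 then ∫ x, f x ∂μ else 0 := by
  have hs : ∀ i j, μ[μ[f|colSup 𝓕 (j + 1)] - μ[f|colSup 𝓕 j]|rowSup 𝓕 i] =ᵐ[μ]
      μ[f|𝓕 i (j + 1)] - μ[f|𝓕 i j] := fun i j =>
    (MeasureTheory.condExp_sub integrable_condExp integrable_condExp _).trans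
      ((h.condExp_row_col i (j + 1) hf).sub (h.condExp_row_col i j hf))
  rcases i with - | i <;> rcases j with - | j <;> simp only [dd, d1, d2]
  · filter_upwards [h.condExp_row_col 0 0 hf] with ω h1
    simp [h1, rectDiff, padBot, condExp_bot]
  · filter_upwards [hs 0 j] with ω h1
    simp [h1, rectDiff, padBot, condExp_bot]
  · filter_upwards [h.condExp_row_col (i + 1) 0 hf, h.condExp_row_col i 0 hf] with ω h1 h2
    simp [h1, h2, rectDiff, padBot, condExp_bot]
  · filter_upwards [hs (i + 1) j, hs i j] with ω h1 h2
    simp [h1, h2, rectDiff, padBot]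
    ring

theorem integrable_dd (h : IsF4Filtration μ 𝓕) {f : Ω → ℝ} (hf : Integrable f μ) (i j : ℕ) :
    Integrable (dd μ 𝓕 i j f) μ :=
  ((integrable_rectDiff μ _ f i j).add (integrable_const _)).congr (dd_ae_eq_rectDiff h hf i j).symm

theorem abs_integral_le_integral_sqFun_dd (h : IsF4Filtration μ 𝓕) {f : Ω → ℝ}
    (hf : Integrable f μ) (N : ℕ) :
    |∫ ω, f ω ∂μ| ≤ ∫ ω, sqFun (fun i j => dd μ 𝓕 i j f) (N + 1) ω ∂μ := by
  have h1 : ∫ ω, dd μ 𝓕 0 0 f ω ∂μ = ∫ ω, f ω ∂μ := by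
    have h2 : dd μ 𝓕 0 0 f =ᵐ[μ] μ[f|𝓕 0 0] := h.condExp_row_col 0 0 hf
    rw [integral_congr_ae h2, integral_condExp (h.le 0 0)]
  rw [← h1]
  exact abs_integral_le_integral_abs.trans (integral_mono (integrable_dd h hf 0 0).abs
    (integrable_sqFun (integrable_dd h hf) _)
    (abs_le_sqFun (fun i j => dd μ 𝓕 i j f) N.succ_pos N.succ_pos))

theorem integral_sqFun_rectDiff_le (h : IsF4Filtration μ 𝓕) {f : Ω → ℝ}
    (hf : Integrable f μ) (N : ℕ) :
    ∫ ω, sqFun (rectDiff μ (padBot 𝓕) f) (N + 1) ω ∂μ ≤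
      2 * ∫ ω, sqFun (fun i j => dd μ 𝓕 i j f) (N + 1) ω ∂μ := by
  have hS := integrable_sqFun (integrable_dd h hf) (N + 1)
  have h1 : ∫ ω, sqFun (rectDiff μ (padBot 𝓕) f) (N + 1) ω ∂μ ≤
      ∫ ω, (sqFun (fun i j => dd μ 𝓕 i j f) (N + 1) ω + |∫ x, f x ∂μ|) ∂μ := by
    refine integral_mono_ae (integrable_sqFun (integrable_rectDiff μ _ f) _)
      (hS.add (integrable_const _)) ?_
    filter_upwards [ae_all_iff.2 fun i => ae_all_iff.2 fun j => dd_ae_eq_rectDiff h hf i j]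
      with ω hω
    refine (sqFun_le_add _ (fun i j => dd μ 𝓕 i j f) (N + 1) ω).trans ?_
    gcongr
    refine (sqFun_le_sum_abs _ _ ω).trans (le_of_eq ?_)
    rw [Finset.sum_eq_single_of_mem 0 (Finset.mem_range.2 N.succ_pos),
      Finset.sum_eq_single_of_mem 0 (Finset.mem_range.2 N.succ_pos)]
    · simp [hω]
    · intro j _ hj
      simp [hω, hj]
    · intro i _ hi
      simp [hω, hi]
  rw [integral_add hS (integrable_const _), integral_const, probReal_univ, one_smul] at h1
  linarith [abs_integral_le_integral_sqFun_dd h hf N]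

theorem ofReal_sqFun_le {Ω : Type*} (y : ℕ → ℕ → Ω → ℝ) (N : ℕ) (ω : Ω) :
    ENNReal.ofReal (sqFun y N ω) ≤
      (∑' (i : ℕ) (j : ℕ), (‖y i j ω‖₊ : ℝ≥0∞) ^ 2) ^ (1 / 2 : ℝ) := by
  rw [sqFun, Real.sqrt_eq_rpow, ← ENNReal.ofReal_rpow_of_nonneg (by positivity) (by norm_num)]
  gcongr
  rw [ENNReal.ofReal_sum_of_nonneg fun i _ => by positivity]
  refine le_trans (Finset.sum_le_sum fun i _ => ?_) (ENNReal.sum_le_tsum (Finset.range N))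
  rw [ENNReal.ofReal_sum_of_nonneg fun i _ => by positivity]
  refine le_trans (Finset.sum_le_sum fun j _ => ?_) (ENNReal.sum_le_tsum (Finset.range N))
  rw [← sq_abs, ENNReal.ofReal_pow (abs_nonneg _), ← Real.norm_eq_abs, ofReal_norm]
  rfl

theorem lintegral_iSup_le_condExp_le (h : IsF4Filtration μ 𝓕) {f : Ω → ℝ} (hf : Integrable f μ)
    (N : ℕ) :
    ∫⁻ ω, ⨆ n ≤ N, ⨆ m ≤ N, (‖(μ[f|𝓕 n m]) ω‖₊ : ℝ≥0∞) ∂μ ≤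
      614401 * ∫⁻ ω, (∑' (i : ℕ) (j : ℕ), (‖dd μ 𝓕 i j f ω‖₊ : ℝ≥0∞) ^ 2) ^ (1 / 2 : ℝ) ∂μ := by
  have hS := integrable_sqFun (integrable_dd h hf) (N + 1)
  have hS0 : 0 ≤ ∫ ω, sqFun (fun i j => dd μ 𝓕 i j f) (N + 1) ω ∂μ :=
    integral_nonneg fun ω => sqFun_nonneg _ _ ω
  have hreal : ∫⁻ ω, ⨆ n ≤ N, ⨆ m ≤ N, (‖(μ[f|𝓕 n m]) ω‖₊ : ℝ≥0∞) ∂μ ≤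
      ENNReal.ofReal (614401 * ∫ ω, sqFun (fun i j => dd μ 𝓕 i j f) (N + 1) ω ∂μ) := by
    refine ENNReal.le_of_forall_pos_le_add fun ε hε _ => ?_
    obtain ⟨G, hG, hle, hi⟩ := h.padBot.isCommutingGrid.exists_dom_condExp
      (padBot_eq_bot 𝓕) hf (N + 1) (ε := ε) hε
    have hG' : Integrable (fun ω => G ω + |∫ x, f x ∂μ|) μ := hG.add (integrable_const _)
    have hb : ∀ᵐ ω ∂μ, ∀ n ≤ N, ∀ m ≤ N, |(μ[f|𝓕 n m]) ω| ≤ G ω + |∫ x, f x ∂μ| := by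
      filter_upwards [hle] with ω hω n hn m hm
      have h1 := hω (n + 1) (by omega) (m + 1) (by omega)
      have h2 := abs_add_le ((μ[f|𝓕 n m]) ω - ∫ x, f x ∂μ) (∫ x, f x ∂μ)
      rw [sub_add_cancel] at h2
      exact h2.trans (by gcongr)
    calc ∫⁻ ω, ⨆ n ≤ N, ⨆ m ≤ N, (‖(μ[f|𝓕 n m]) ω‖₊ : ℝ≥0∞) ∂μ
        ≤ ∫⁻ ω, ENNReal.ofReal (G ω + |∫ x, f x ∂μ|) ∂μ := by
          refine lintegral_mono_ae ?_
          filter_upwards [hb] with ω hω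
          refine iSup₂_le fun n hn => iSup₂_le fun m hm => ?_
          rw [← enorm_eq_nnnorm, ← ofReal_norm, Real.norm_eq_abs]
          exact ENNReal.ofReal_le_ofReal (hω n hn m hm)
      _ = ENNReal.ofReal (∫ ω, (G ω + |∫ x, f x ∂μ|) ∂μ) := by
          refine (ofReal_integral_eq_lintegral_ofReal hG' ?_).symm
          filter_upwards [hb] with ω hω
          exact (abs_nonneg _).trans (hω 0 N.zero_le 0 N.zero_le)
      _ ≤ ENNReal.ofReal
          (614401 * ∫ ω, sqFun (fun i j => dd μ 𝓕 i j f) (N + 1) ω ∂μ + ε) := by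
          refine ENNReal.ofReal_le_ofReal ?_
          rw [integral_add hG (integrable_const _), integral_const, probReal_univ, one_smul]
          linarith [abs_integral_le_integral_sqFun_dd h hf N, integral_sqFun_rectDiff_le h hf N]
      _ = _ := by
          rw [ENNReal.ofReal_add (by positivity) ε.coe_nonneg, ENNReal.ofReal_coe_nnreal]
  refine hreal.trans ?_
  rw [ENNReal.ofReal_mul (by norm_num), ENNReal.ofReal_ofNat,
    ofReal_integral_eq_lintegral_ofReal hS (.of_forall fun ω => sqFun_nonneg _ _ ω)]
  gcongr
  exact ofReal_sqFun_le _ _ _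

end Padding

/-- For every two-parameter filtration satisfying (F4) on any probability
space, and every `f ∈ L¹(ℱ_{∞,∞})`, one has `𝔼[sup_{n,m} |𝔼_{n,m} f|] ≤ C · 𝔼[Sf]`
with a universal constant `C`, where `Sf = (Σ_{i,j} |Δ_{i,j} f|²)^{1/2}`. -/
theorem maximal_le_square_two_parameter :
    ∃ C : ℝ≥0∞, 0 < C ∧ C ≠ ∞ ∧
      ∀ (Ω : Type*) [MeasurableSpace Ω] (μ : Measure Ω) [IsProbabilityMeasure μ]
        (𝓕 : ℕ → ℕ → MeasurableSpace Ω), IsF4Filtration μ 𝓕 →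
        ∀ f : Ω → ℝ, Integrable f μ → Measurable[(⨆ i, ⨆ j, 𝓕 i j)] f →
          ∫⁻ ω, ⨆ n, ⨆ m, (‖(μ[f|𝓕 n m]) ω‖₊ : ℝ≥0∞) ∂μ ≤
            C * ∫⁻ ω, (∑' (i : ℕ) (j : ℕ), (‖dd μ 𝓕 i j f ω‖₊ : ℝ≥0∞) ^ 2) ^ (1/2 : ℝ) ∂μ := by
  refine ⟨614401, by norm_num, by norm_num, fun Ω _ μ _ 𝓕 h f hf _ => ?_⟩
  have hmeas : ∀ n m, Measurable fun ω => (‖(μ[f|𝓕 n m]) ω‖₊ : ℝ≥0∞) := fun n m =>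
    (stronglyMeasurable_condExp.mono (h.le n m)).measurable.nnnorm.coe_nnreal_ennreal
  have hsup : ∀ ω, ⨆ n, ⨆ m, (‖(μ[f|𝓕 n m]) ω‖₊ : ℝ≥0∞) =
      ⨆ N, ⨆ n ≤ N, ⨆ m ≤ N, (‖(μ[f|𝓕 n m]) ω‖₊ : ℝ≥0∞) := fun ω =>
    le_antisymm
      (iSup₂_le fun n m => le_iSup_of_le (max n m) <| le_iSup₂_of_le n (le_max_left n m) <|
        le_iSup₂_of_le m (le_max_right n m) le_rfl)
      (iSup_le fun N => iSup₂_le fun n _ => iSup₂_le fun m _ => le_iSup₂_of_le n m le_rfl)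
  simp only [hsup]
  rw [lintegral_iSup]
  · exact iSup_le fun N => lintegral_iSup_le_condExp_le h hf N
  · exact fun N => .iSup fun n => .iSup fun _ => .iSup fun m => .iSup fun _ => hmeas n m
  · exact fun N K hNK ω => iSup₂_le fun n hn => iSup₂_le fun m hm =>
      le_iSup₂_of_le n (hn.trans hNK) <| le_iSup₂_of_le m (hm.trans hNK) le_rfl
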